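/- arXiv:2101.03534 — 3 statements merged into one kernel-verified Lean document; each statement's English description precedes it below -/
import Mathlib

section
/- Let n ≥ 1 and let R_0 = {0}^{2n-2} × [0,∞) × {0} ⊂ ℝ^{2n} (the ray in the x_n-axis). Then R_0 is time-independent Hamiltonian excisable from (ℝ^{2n}, ω_can): there exists a smooth function F : ℝ^{2n} → ℝ such that every forward trajectory of the flow of the Hamiltonian vector field X_F that starts in R_0 stays in R_0 as long as it is defined, the maximal integral curve of X_F starting at any z ∈ ℝ^{2n} ∖ R_0 is defined at least on [0,1], and the time-1 flow map of X_F is a symplectomorphism from ℝ^{2n} ∖ R_0 onto ℝ^{2n}. -/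
open Set

noncomputable section

/-- `ℝ^{2n}` presented as `(p, xₙ, yₙ)` with `p = (x₁,y₁,…,x_{n-1},y_{n-1}) ∈ ℝ^{2(n-1)}`;
here `m = n - 1`, so `n ≥ 1` corresponds to arbitrary `m : ℕ`. -/
abbrev EE (m : ℕ) := ((Fin m → ℝ) × (Fin m → ℝ)) × ℝ × ℝ

/-- The standard symplectic form on `ℝ^{2m}`, `ω(u,v) = Σᵢ (u_{xᵢ} v_{yᵢ} - u_{yᵢ} v_{xᵢ})`. -/
def wB (m : ℕ) (u v : (Fin m → ℝ) × (Fin m → ℝ)) : ℝ :=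
  ∑ i, (u.1 i * v.2 i - u.2 i * v.1 i)

/-- The standard symplectic form `ω_can` on `ℝ^{2n} = ℝ^{2m} × ℝ × ℝ`. -/
def wcan (m : ℕ) (u v : EE m) : ℝ :=
  wB m u.1 v.1 + (u.2.1 * v.2.2 - u.2.2 * v.2.1)

/-- The ray `R₀ = {0}^{2n-2} × [0,∞) × {0}` along the positive `xₙ`-axis. -/
def R0 (m : ℕ) : Set (EE m) := {z | z.1 = 0 ∧ 0 ≤ z.2.1 ∧ z.2.2 = 0}

/-- The squared Euclidean norm on `ℝ^{2m}`. -/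
def normSqB {m : ℕ} (p : (Fin m → ℝ) × (Fin m → ℝ)) : ℝ := ∑ i, (p.1 i ^ 2 + p.2 i ^ 2)

/-- Simultaneous multiplication of all pairs `(xᵢ, yᵢ)` by the complex number `c - i s`. -/
def rotB {m : ℕ} (c s : ℝ) (p : (Fin m → ℝ) × (Fin m → ℝ)) : (Fin m → ℝ) × (Fin m → ℝ) :=
  (fun i => c * p.1 i + s * p.2 i, fun i => c * p.2 i - s * p.1 i)

lemma normSqB_nonneg {m : ℕ} (p : (Fin m → ℝ) × (Fin m → ℝ)) : 0 ≤ normSqB p :=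
  Finset.sum_nonneg fun _ _ => by positivity

lemma normSqB_eq_zero {m : ℕ} {p : (Fin m → ℝ) × (Fin m → ℝ)} : normSqB p = 0 ↔ p = 0 := by
  constructor
  · intro h
    have h' := (Finset.sum_eq_zero_iff_of_nonneg (fun i _ => by positivity)).1 h
    have h1 : ∀ i, p.1 i = 0 ∧ p.2 i = 0 := fun i => by
      have := h' i (Finset.mem_univ i)
      constructor <;> nlinarith [sq_nonneg (p.1 i), sq_nonneg (p.2 i)]
    ext i
    · exact (h1 i).1
    · exact (h1 i).2
  · rintro rfl
    simp [normSqB]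

lemma normSqB_rotB {m : ℕ} {c s : ℝ} (h : c ^ 2 + s ^ 2 = 1) (p : (Fin m → ℝ) × (Fin m → ℝ)) :
    normSqB (rotB c s p) = normSqB p := by
  unfold normSqB rotB
  refine Finset.sum_congr rfl fun i _ => ?_
  linear_combination (p.1 i ^ 2 + p.2 i ^ 2) * h

lemma rotB_neg_rotB {m : ℕ} {c s : ℝ} (h : c ^ 2 + s ^ 2 = 1)
    (p : (Fin m → ℝ) × (Fin m → ℝ)) : rotB c (-s) (rotB c s p) = p := by
  unfold rotB
  ext i
  · simp only
    linear_combination p.1 i * h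
  · simp only
    linear_combination p.2 i * h

lemma rotB_rotB_neg {m : ℕ} {c s : ℝ} (h : c ^ 2 + s ^ 2 = 1)
    (p : (Fin m → ℝ) × (Fin m → ℝ)) : rotB c s (rotB c (-s) p) = p := by
  have := rotB_neg_rotB (c := c) (s := -s) (by linear_combination h) p
  rwa [neg_neg] at this

lemma ContDiff.normSqB {m : ℕ} {n : WithTop ℕ∞} :
    ContDiff ℝ n (normSqB : (Fin m → ℝ) × (Fin m → ℝ) → ℝ) := by
  unfold _root_.normSqB
  fun_prop

/-- The quantity `|P|² + 4 e^{-2x}`. -/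
def kFun {m : ℕ} (z : EE m) : ℝ := 4 * Real.exp (-z.2.1) ^ 2 + normSqB z.1

/-- The quantity `√(k² + 4 y²)` with `k = |P|² + 4 e^{-2x}`. -/
def rhoFun {m : ℕ} (z : EE m) : ℝ := √(kFun z ^ 2 + 4 * z.2.2 ^ 2)

/-- A symplectic embedding of `ℝ^{2n}` onto the complement of the ray `R0`. -/
def toSlit {m : ℕ} (z : EE m) : EE m :=
  (rotB (kFun z / rhoFun z) (2 * z.2.2 / rhoFun z) z.1,
    (rhoFun z / (4 * Real.exp (-z.2.1)) - 2 * kFun z * Real.exp (-z.2.1) / rhoFun z,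
      4 * z.2.2 * Real.exp (-z.2.1) / rhoFun z))

/-- The Euclidean norm on `ℝ^{2n}`. -/
def radius {m : ℕ} (w : EE m) : ℝ := √(w.2.1 ^ 2 + w.2.2 ^ 2 + normSqB w.1)

/-- The modulus of `(r - T) + i E`, where `r` is the Euclidean norm and `(T, E) = (xₙ, yₙ)`. -/
def modFun {m : ℕ} (w : EE m) : ℝ := √((radius w - w.2.1) ^ 2 + w.2.2 ^ 2)

/-- The inverse of `toSlit` on the complement of `R0`. -/
def fromSlit {m : ℕ} (w : EE m) : EE m :=
  (rotB ((radius w - w.2.1) / modFun w) (-(w.2.2 / modFun w)) w.1,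
    (-Real.log (modFun w / 2), radius w * w.2.2))

lemma kFun_pos {m : ℕ} (z : EE m) : 0 < kFun z := by
  have := normSqB_nonneg z.1
  unfold kFun
  positivity

lemma rhoFun_sq {m : ℕ} (z : EE m) : rhoFun z ^ 2 = kFun z ^ 2 + 4 * z.2.2 ^ 2 :=
  Real.sq_sqrt (by positivity)

lemma rhoFun_pos {m : ℕ} (z : EE m) : 0 < rhoFun z := by
  have := kFun_pos z
  exact Real.sqrt_pos.2 (by positivity)

lemma toSlit_rotation {m : ℕ} (z : EE m) :
    (kFun z / rhoFun z) ^ 2 + (2 * z.2.2 / rhoFun z) ^ 2 = 1 := by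
  have := rhoFun_pos z
  field_simp
  linear_combination -rhoFun_sq z

lemma normSqB_toSlit {m : ℕ} (z : EE m) : normSqB (toSlit z).1 = normSqB z.1 :=
  normSqB_rotB (toSlit_rotation z) _

lemma contDiff_kFun {m : ℕ} : ContDiff ℝ (⊤ : ℕ∞) (kFun : EE m → ℝ) := by
  have := ContDiff.normSqB (m := m) (n := (⊤ : ℕ∞))
  unfold kFun
  fun_prop

lemma contDiff_rhoFun {m : ℕ} : ContDiff ℝ (⊤ : ℕ∞) (rhoFun : EE m → ℝ) := by
  have := contDiff_kFun (m := m)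
  unfold rhoFun
  refine ContDiff.sqrt (by fun_prop) fun z => ?_
  have := kFun_pos z
  positivity

lemma contDiff_toSlit {m : ℕ} : ContDiff ℝ (⊤ : ℕ∞) (toSlit : EE m → EE m) := by
  have h1 := contDiff_kFun (m := m)
  have h2 := contDiff_rhoFun (m := m)
  have h3 : ∀ z : EE m, rhoFun z ≠ 0 := fun z => (rhoFun_pos z).ne'
  have h4 : ∀ z : EE m, 4 * Real.exp (-z.2.1) ≠ 0 := fun z => by positivity
  have hc : ContDiff ℝ (⊤ : ℕ∞) fun z : EE m => kFun z / rhoFun z := h1.div h2 h3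
  have hs : ContDiff ℝ (⊤ : ℕ∞) fun z : EE m => 2 * z.2.2 / rhoFun z :=
    ContDiff.div (by fun_prop) h2 h3
  have hT : ContDiff ℝ (⊤ : ℕ∞) fun z : EE m => rhoFun z / (4 * Real.exp (-z.2.1)) -
      2 * kFun z * Real.exp (-z.2.1) / rhoFun z :=
    ContDiff.sub (h2.div (by fun_prop) h4) (ContDiff.div (by fun_prop) h2 h3)
  have hE : ContDiff ℝ (⊤ : ℕ∞) fun z : EE m => 4 * z.2.2 * Real.exp (-z.2.1) / rhoFun z :=
    ContDiff.div (by fun_prop) h2 h3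
  unfold toSlit rotB
  fun_prop

lemma toSlit_axis_iff {m : ℕ} (z : EE m) :
    ((toSlit z).1 = 0 ∧ (toSlit z).2.2 = 0) ↔ (z.1 = 0 ∧ z.2.2 = 0) := by
  rw [← normSqB_eq_zero, normSqB_toSlit, normSqB_eq_zero]
  have := rhoFun_pos z
  have h2 := Real.exp_pos (-z.2.1)
  simp [toSlit, this.ne']

lemma toSlit_axis {m : ℕ} {z : EE m} (h1 : z.1 = 0) (h2 : z.2.2 = 0) :
    (toSlit z).2.1 = -Real.exp (-z.2.1) := by
  have hk : kFun z = 4 * Real.exp (-z.2.1) ^ 2 := by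
    rw [kFun, normSqB_eq_zero.2 h1, add_zero]
  have hr : rhoFun z = kFun z := by
    rw [rhoFun, h2]
    simpa using Real.sqrt_sq (kFun_pos z).le
  have h2 := Real.exp_pos (-z.2.1)
  simp only [toSlit]
  rw [hr, hk]
  field_simp
  ring

lemma toSlit_notMem {m : ℕ} (z : EE m) : toSlit z ∉ R0 m := by
  rintro ⟨h1, h2, h3⟩
  obtain ⟨h4, h5⟩ := (toSlit_axis_iff z).1 ⟨h1, h3⟩
  rw [toSlit_axis h4 h5] at h2
  linarith [Real.exp_pos (-z.2.1)]

lemma toSlit_add_mem_iff {m : ℕ} (z : EE m) :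
    toSlit z + ((0, (1, 0)) : EE m) ∈ R0 m ↔ z ∈ R0 m := by
  have key : toSlit z + ((0, (1, 0)) : EE m) ∈ R0 m ↔
      ((toSlit z).1 = 0 ∧ (toSlit z).2.2 = 0) ∧ 0 ≤ (toSlit z).2.1 + 1 := by
    simp only [R0, mem_ofPred_eq, Prod.fst_add, Prod.snd_add, add_zero]
    tauto
  rw [key, toSlit_axis_iff]
  have : ∀ h : z.1 = 0 ∧ z.2.2 = 0, 0 ≤ (toSlit z).2.1 + 1 ↔ 0 ≤ z.2.1 := fun h => by
    rw [toSlit_axis h.1 h.2, neg_add_eq_sub, sub_nonneg, Real.exp_le_one_iff, neg_nonpos]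
  simp only [R0, mem_ofPred_eq]
  tauto

lemma radius_sub_pos {m : ℕ} {w : EE m} (hw : w ∉ R0 m) : 0 < radius w - w.2.1 := by
  have hn := normSqB_nonneg w.1
  rw [sub_pos]
  by_contra! h
  have h0 : 0 ≤ w.2.1 := (Real.sqrt_nonneg _).trans h
  have h1 := (Real.sqrt_le_left h0).1 h
  have h2 : w.2.2 = 0 := by nlinarith [sq_nonneg w.2.2]
  have h3 : normSqB w.1 = 0 := by nlinarith [sq_nonneg w.2.2]
  exact hw ⟨normSqB_eq_zero.1 h3, h0, h2⟩

lemma radius_sq {m : ℕ} (w : EE m) :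
    radius w ^ 2 = w.2.1 ^ 2 + w.2.2 ^ 2 + normSqB w.1 :=
  Real.sq_sqrt (by have := normSqB_nonneg w.1; positivity)

lemma radius_pos {m : ℕ} {w : EE m} (hw : w ∉ R0 m) : 0 < radius w := by
  have h0 := radius_sub_pos hw
  have h1 : 0 ≤ radius w := Real.sqrt_nonneg _
  refine h1.lt_of_ne fun h => ?_
  have h2 := radius_sq w
  have h3 := normSqB_nonneg w.1
  rw [← h] at h0 h2
  nlinarith [sq_nonneg w.2.2]

lemma modFun_sq {m : ℕ} (w : EE m) :
    modFun w ^ 2 = (radius w - w.2.1) ^ 2 + w.2.2 ^ 2 :=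
  Real.sq_sqrt (by positivity)

lemma modFun_pos {m : ℕ} {w : EE m} (hw : w ∉ R0 m) : 0 < modFun w := by
  have := radius_sub_pos hw
  exact Real.sqrt_pos.2 (by positivity)

lemma fromSlit_rotation {m : ℕ} {w : EE m} (hw : w ∉ R0 m) :
    ((radius w - w.2.1) / modFun w) ^ 2 + (w.2.2 / modFun w) ^ 2 = 1 := by
  have := modFun_pos hw
  field_simp
  linear_combination -modFun_sq w

lemma toSlit_fromSlit {m : ℕ} {w : EE m} (hw : w ∉ R0 m) : toSlit (fromSlit w) = w := by
  have hr := radius_pos hw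
  have hb := modFun_pos hw
  have hrot := fromSlit_rotation hw
  have hS : normSqB (fromSlit w).1 = normSqB w.1 :=
    normSqB_rotB (by linear_combination hrot) _
  have he : Real.exp (-(fromSlit w).2.1) = modFun w / 2 := by
    simp only [fromSlit, neg_neg]
    exact Real.exp_log (by positivity)
  have hk : kFun (fromSlit w) = 2 * radius w * (radius w - w.2.1) := by
    rw [kFun, he, hS]
    linear_combination modFun_sq w - radius_sq w
  have hy : (fromSlit w).2.2 = radius w * w.2.2 := rfl
  have hrho : rhoFun (fromSlit w) = 2 * radius w * modFun w := by
    rw [rhoFun, hk, hy, Real.sqrt_eq_iff_mul_self_eq_of_pos (by positivity)]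
    linear_combination 4 * radius w ^ 2 * modFun_sq w
  have hc : 2 * radius w * (radius w - w.2.1) / (2 * radius w * modFun w) =
      (radius w - w.2.1) / modFun w := by field_simp
  have hs : 2 * (radius w * w.2.2) / (2 * radius w * modFun w) = w.2.2 / modFun w := by
    field_simp
  refine Prod.ext ?_ (Prod.ext ?_ ?_)
  · simp only [toSlit]
    rw [hk, hrho, hy, hc, hs]
    exact rotB_rotB_neg hrot _
  · simp only [toSlit]
    rw [hk, hrho, he]
    field_simp
    ring
  · simp only [toSlit]
    rw [hrho, he, hy]
    field_simp
    ring

lemma fromSlit_toSlit {m : ℕ} (z : EE m) : fromSlit (toSlit z) = z := by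
  have hk := kFun_pos z
  have hrho := rhoFun_pos z
  have he := Real.exp_pos (-z.2.1)
  have hsq := rhoFun_sq z
  have hr : radius (toSlit z) = rhoFun z / (4 * Real.exp (-z.2.1)) := by
    rw [radius, normSqB_toSlit, Real.sqrt_eq_iff_mul_self_eq_of_pos (by positivity)]
    have hkk : normSqB z.1 = kFun z - 4 * Real.exp (-z.2.1) ^ 2 := by rw [kFun]; ring
    rw [hkk]
    simp only [toSlit]
    field_simp
    linear_combination (64 * Real.exp (-z.2.1) ^ 4) * hsq
  have ha : radius (toSlit z) - (toSlit z).2.1 =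
      2 * kFun z * Real.exp (-z.2.1) / rhoFun z := by
    rw [hr]
    simp only [toSlit]
    ring
  have hE : (toSlit z).2.2 = 4 * z.2.2 * Real.exp (-z.2.1) / rhoFun z := rfl
  have hb : modFun (toSlit z) = 2 * Real.exp (-z.2.1) := by
    rw [modFun, ha, hE, Real.sqrt_eq_iff_mul_self_eq_of_pos (by positivity)]
    field_simp
    linear_combination 4 * hsq
  refine Prod.ext ?_ (Prod.ext ?_ ?_)
  · simp only [fromSlit]
    rw [ha, hb, hE]
    have hc : 2 * kFun z * Real.exp (-z.2.1) / rhoFun z / (2 * Real.exp (-z.2.1)) =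
      kFun z / rhoFun z := by field_simp
    have hs : 4 * z.2.2 * Real.exp (-z.2.1) / rhoFun z / (2 * Real.exp (-z.2.1)) =
      2 * z.2.2 / rhoFun z := by field_simp; ring
    rw [hc, hs]
    exact rotB_neg_rotB (toSlit_rotation z) _
  · simp only [fromSlit]
    rw [hb, mul_div_cancel_left₀ _ two_ne_zero, Real.log_exp, neg_neg]
  · simp only [fromSlit]
    rw [hr, hE]
    field_simp

lemma contDiffAt_fromSlit {m : ℕ} {w : EE m} (hw : w ∉ R0 m) :
    ContDiffAt ℝ (⊤ : ℕ∞) (fromSlit : EE m → EE m) w := by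
  have hn := ContDiff.normSqB (m := m) (n := (⊤ : ℕ∞))
  have hr : ContDiffAt ℝ (⊤ : ℕ∞) (radius : EE m → ℝ) w := by
    unfold radius
    refine ContDiffAt.sqrt (by fun_prop) ?_
    have h1 := radius_pos hw
    rw [← radius_sq]
    positivity
  have hb : ContDiffAt ℝ (⊤ : ℕ∞) (modFun : EE m → ℝ) w := by
    unfold modFun
    refine ContDiffAt.sqrt (by fun_prop) ?_
    have h1 := modFun_pos hw
    rw [← modFun_sq]
    positivity
  have hb0 := modFun_pos hw
  have hc : ContDiffAt ℝ (⊤ : ℕ∞) (fun w : EE m => (radius w - w.2.1) / modFun w) w :=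
    ContDiffAt.div (by fun_prop) hb hb0.ne'
  have hs : ContDiffAt ℝ (⊤ : ℕ∞) (fun w : EE m => w.2.2 / modFun w) w :=
    ContDiffAt.div (by fun_prop) hb hb0.ne'
  have hx : ContDiffAt ℝ (⊤ : ℕ∞) (fun w : EE m => Real.log (modFun w / 2)) w :=
    ContDiffAt.log (by fun_prop) (by positivity)
  unfold fromSlit rotB
  fun_prop

lemma hasDerivAt_normSqB_line {m : ℕ} (p u : (Fin m → ℝ) × (Fin m → ℝ)) :
    HasDerivAt (fun t : ℝ => normSqB (p + t • u))
      (2 * ∑ i, (p.1 i * u.1 i + p.2 i * u.2 i)) 0 := by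
  unfold normSqB
  rw [Finset.mul_sum]
  refine HasDerivAt.fun_sum fun i _ => ?_
  have h (a b : ℝ) : HasDerivAt (fun t : ℝ => a + t * b) b 0 := by
    simpa using ((hasDerivAt_id (0 : ℝ)).mul_const b).const_add a
  convert ((h (p.1 i) (u.1 i)).fun_pow 2).fun_add ((h (p.2 i) (u.2 i)).fun_pow 2) using 1
  simp
  ring

/-- The directional derivative of `kFun` at `z` along `u`. -/
def kDer {m : ℕ} (z u : EE m) : ℝ :=
  2 * ∑ i, (z.1.1 i * u.1.1 i + z.1.2 i * u.1.2 i) - 8 * Real.exp (-z.2.1) ^ 2 * u.2.1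

/-- The directional derivative of `rhoFun` at `z` along `u`. -/
def rhoDer {m : ℕ} (z u : EE m) : ℝ :=
  (kFun z * kDer z u + 4 * z.2.2 * u.2.2) / rhoFun z

/-- The directional derivative at `z` along `u` of the rotation angle of `toSlit`. -/
def angDer {m : ℕ} (z u : EE m) : ℝ :=
  2 * (kFun z * u.2.2 - z.2.2 * kDer z u) / rhoFun z ^ 2

/-- The directional derivative of `toSlit` at `z` along `u`. -/
def toSlitDer {m : ℕ} (z u : EE m) : EE m :=
  ((rotB (kFun z / rhoFun z) (2 * z.2.2 / rhoFun z) u.1 +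
    angDer z u • rotB (-(2 * z.2.2 / rhoFun z)) (kFun z / rhoFun z) z.1),
    (rhoDer z u / (4 * Real.exp (-z.2.1)) + rhoFun z * u.2.1 / (4 * Real.exp (-z.2.1))
      - 2 * (kDer z u - kFun z * u.2.1) * Real.exp (-z.2.1) / rhoFun z
      + 2 * kFun z * Real.exp (-z.2.1) * rhoDer z u / rhoFun z ^ 2,
    4 * (u.2.2 - z.2.2 * u.2.1) * Real.exp (-z.2.1) / rhoFun z
      - 4 * z.2.2 * Real.exp (-z.2.1) * rhoDer z u / rhoFun z ^ 2))

lemma hasDerivAt_toSlit_line {m : ℕ} (z u : EE m) :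
    HasDerivAt (fun t : ℝ => toSlit (z + t • u)) (toSlitDer z u) 0 := by
  have hρ := rhoFun_pos z
  have hρ2 := rhoFun_sq z
  have hk0 := kFun_pos z
  have he0 := Real.exp_pos (-z.2.1)
  have z0 : z + (0 : ℝ) • u = z := by simp
  have line (a b : ℝ) : HasDerivAt (fun t : ℝ => a + t * b) b 0 := by
    simpa using ((hasDerivAt_id (0 : ℝ)).mul_const b).const_add a
  have he : HasDerivAt (fun t : ℝ => Real.exp (-(z + t • u).2.1))
      (-(Real.exp (-z.2.1) * u.2.1)) 0 := by
    simpa using (line z.2.1 u.2.1).fun_neg.exp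
  have hy : HasDerivAt (fun t : ℝ => (z + t • u).2.2) u.2.2 0 := line z.2.2 u.2.2
  have hk : HasDerivAt (fun t : ℝ => kFun (z + t • u)) (kDer z u) 0 := by
    refine HasDerivAt.congr_deriv (((he.fun_pow 2).const_mul 4).fun_add (hasDerivAt_normSqB_line z.1 u.1)) (Eq.symm ?_)
    rw [z0, kDer]
    simp
    ring
  have hr : HasDerivAt (fun t : ℝ => rhoFun (z + t • u)) (rhoDer z u) 0 := by
    refine (((hk.fun_pow 2).fun_add ((hy.fun_pow 2).const_mul 4)).sqrt ?_).congr_deriv (Eq.symm ?_)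
    · rw [z0]
      positivity
    · rw [z0, ← rhoFun_sq, Real.sqrt_sq hρ.le, rhoDer]
      field_simp
      simp
      ring
  have hρz : rhoFun (z + (0 : ℝ) • u) ≠ 0 := by rw [z0]; exact hρ.ne'
  have hc : HasDerivAt (fun t : ℝ => kFun (z + t • u) / rhoFun (z + t • u))
      (angDer z u * -(2 * z.2.2 / rhoFun z)) 0 := by
    refine HasDerivAt.congr_deriv (hk.fun_div hr hρz) (Eq.symm ?_)
    rw [z0, rhoDer, angDer]
    field_simp
    linear_combination (-kDer z u) * hρ2
  have hs : HasDerivAt (fun t : ℝ => 2 * (z + t • u).2.2 / rhoFun (z + t • u))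
      (angDer z u * (kFun z / rhoFun z)) 0 := by
    refine HasDerivAt.congr_deriv ((hy.const_mul 2).fun_div hr hρz) (Eq.symm ?_)
    rw [z0, rhoDer, angDer]
    field_simp
    linear_combination (-u.2.2) * hρ2
  refine HasDerivAt.prodMk (HasDerivAt.prodMk ?_ ?_) (HasDerivAt.prodMk ?_ ?_)
  · refine hasDerivAt_pi.2 fun i => ?_
    refine HasDerivAt.congr_deriv ((hc.fun_mul (line (z.1.1 i) (u.1.1 i))).fun_add
      (hs.fun_mul (line (z.1.2 i) (u.1.2 i)))) (Eq.symm ?_)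
    rw [z0]
    simp [rotB]
    ring
  · refine hasDerivAt_pi.2 fun i => ?_
    refine HasDerivAt.congr_deriv ((hc.fun_mul (line (z.1.2 i) (u.1.2 i))).fun_sub
      (hs.fun_mul (line (z.1.1 i) (u.1.1 i)))) (Eq.symm ?_)
    rw [z0]
    simp [rotB]
    ring
  · refine HasDerivAt.congr_deriv ((hr.fun_div (he.const_mul 4) (by positivity)).fun_sub
      (((hk.const_mul 2).fun_mul he).fun_div hr hρz)) (Eq.symm ?_)
    rw [z0]
    field_simp
    ring
  · refine HasDerivAt.congr_deriv (((hy.const_mul 4).fun_mul he).fun_div hr hρz) (Eq.symm ?_)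
    rw [z0]
    field_simp
    ring

lemma fderiv_toSlit_apply {m : ℕ} (z u : EE m) : fderiv ℝ toSlit z u = toSlitDer z u := by
  have h1 : HasFDerivAt toSlit (fderiv ℝ toSlit z) (z : EE m) :=
    (contDiff_toSlit.differentiable (by simp) z).hasFDerivAt
  have h2 : HasDerivAt (fun t : ℝ => z + t • u) u 0 := by
    simpa using ((hasDerivAt_id (0 : ℝ)).smul_const u).const_add z
  have h3 : HasFDerivAt toSlit (fderiv ℝ toSlit z) (z + (0 : ℝ) • u) := by simpa using h1
  exact (HasFDerivAt.comp_hasDerivAt (l := toSlit) (0 : ℝ) h3 h2).unique (hasDerivAt_toSlit_line z u)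

lemma wB_rotB_add {m : ℕ} {c s : ℝ} (h : c ^ 2 + s ^ 2 = 1) (a b : ℝ)
    (p u v : (Fin m → ℝ) × (Fin m → ℝ)) :
    wB m (rotB c s u + a • rotB (-s) c p) (rotB c s v + b • rotB (-s) c p) =
      wB m u v + a * ∑ i, (p.1 i * v.1 i + p.2 i * v.2 i)
        - b * ∑ i, (p.1 i * u.1 i + p.2 i * u.2 i) := by
  unfold wB rotB
  rw [Finset.mul_sum, Finset.mul_sum, ← Finset.sum_add_distrib, ← Finset.sum_sub_distrib]
  refine Finset.sum_congr rfl fun i _ => ?_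
  simp
  linear_combination (u.1 i * v.2 i - u.2 i * v.1 i + a * (p.1 i * v.1 i + p.2 i * v.2 i)
    - b * (p.1 i * u.1 i + p.2 i * u.2 i)) * h

/-- `toSlit` is symplectic. -/
lemma wcan_fderiv_toSlit {m : ℕ} (z u v : EE m) :
    wcan m (fderiv ℝ toSlit z u) (fderiv ℝ toSlit z v) = wcan m u v := by
  have hρ := rhoFun_pos z
  have hρ2 := rhoFun_sq z
  have he := Real.exp_pos (-z.2.1)
  rw [fderiv_toSlit_apply, fderiv_toSlit_apply]
  unfold wcan toSlitDer
  simp only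
  rw [wB_rotB_add (toSlit_rotation z)]
  unfold rhoDer angDer kDer
  generalize (∑ i, (z.1.1 i * u.1.1 i + z.1.2 i * u.1.2 i)) = A
  generalize (∑ i, (z.1.1 i * v.1.1 i + z.1.2 i * v.1.2 i)) = B
  generalize rhoFun z = ρ at *
  generalize kFun z = k at *
  generalize Real.exp (-z.2.1) = e at *
  generalize z.2.2 = y at *
  generalize u.2.1 = ux
  generalize u.2.2 = uy
  generalize v.2.1 = vx
  generalize v.2.2 = vy
  field_simp
  grind

lemma isClosed_R0 {m : ℕ} : IsClosed (R0 m) := by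
  have h1 : IsClosed {z : EE m | z.1 = 0} := isClosed_eq (by fun_prop) (by fun_prop)
  have h2 : IsClosed {z : EE m | 0 ≤ z.2.1} := isClosed_le (by fun_prop) (by fun_prop)
  have h3 : IsClosed {z : EE m | z.2.2 = 0} := isClosed_eq (by fun_prop) (by fun_prop)
  exact h1.inter (h2.inter h3)

/-- The ray `R₀` is time-independent Hamiltonian excisable from `(ℝ^{2n}, ω_can)`:
there is a smooth `F : ℝ^{2n} → ℝ`, with Hamiltonian vector field `X = X_F`
(characterized by `ω_can(X z, w) = dF_z w`), such that forward trajectories starting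
in `R₀` stay in `R₀` as long as they are defined, trajectories starting outside `R₀`
are defined at least on `[0,1]`, and the time-1 flow map `φ` is a symplectomorphism
from `ℝ^{2n} ∖ R₀` onto `ℝ^{2n}`. -/
theorem ray_timeIndependent_hamiltonian_excisable (m : ℕ) :
    ∃ F : EE m → ℝ, ContDiff ℝ (⊤ : ℕ∞) F ∧
    ∃ X : EE m → EE m,
      (∀ z w, wcan m (X z) w = fderiv ℝ F z w) ∧
      (∀ (γ : ℝ → EE m) (T : ℝ), 0 ≤ T → γ 0 ∈ R0 m →
        (∀ t ∈ Icc 0 T, HasDerivAt γ (X (γ t)) t) →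
        ∀ t ∈ Icc 0 T, γ t ∈ R0 m) ∧
      ∃ φ : EE m → EE m,
        (∀ z ∉ R0 m, ∃ γ : ℝ → EE m, γ 0 = z ∧
          (∀ t ∈ Icc (0:ℝ) 1, HasDerivAt γ (X (γ t)) t) ∧ γ 1 = φ z) ∧
        ContDiffOn ℝ (⊤ : ℕ∞) φ (R0 m)ᶜ ∧
        BijOn φ (R0 m)ᶜ univ ∧
        (∃ ψ : EE m → EE m, ContDiff ℝ (⊤ : ℕ∞) ψ ∧ InvOn ψ φ (R0 m)ᶜ univ) ∧
        (∀ z ∉ R0 m, ∀ u v, wcan m (fderiv ℝ φ z u) (fderiv ℝ φ z v) = wcan m u v) := by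
  have hB : ∀ z : EE m, toSlit z ∉ R0 m := toSlit_notMem
  set e : EE m := (0, (1, 0)) with he
  have hdiff : Differentiable ℝ (toSlit : EE m → EE m) := contDiff_toSlit.differentiable (by simp)
  have mono (w : EE m) (t : ℝ) (ht : 0 ≤ t) (hw : w ∈ R0 m) : w + t • e ∈ R0 m := by
    obtain ⟨h1, h2, h3⟩ := hw
    refine ⟨by simp [he, h1], ?_, by simp [he, h3]⟩
    simp only [he, Prod.snd_add, Prod.fst_add, Prod.smul_snd, Prod.smul_fst, smul_eq_mul, mul_one]
    positivity
  have hnot (z : EE m) (hz : z ∉ R0 m) (t : ℝ) (ht : t ≤ 1) : toSlit z + t • e ∉ R0 m := by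
    intro h
    refine hz ((toSlit_add_mem_iff z).1 ?_)
    have := mono _ (1 - t) (by linarith) h
    rwa [add_assoc, ← add_smul, add_sub_cancel, one_smul] at this
  have hnot1 (z : EE m) (hz : z ∉ R0 m) : toSlit z + e ∉ R0 m := by
    simpa using hnot z hz 1 le_rfl
  have hopen : ∀ w : EE m, w ∉ R0 m → ∀ᶠ w' in nhds w, w' ∉ R0 m := fun w hw =>
    isClosed_R0.isOpen_compl.mem_nhds hw
  have hfrom (w : EE m) (hw : w ∉ R0 m) : HasFDerivAt fromSlit (fderiv ℝ fromSlit w) w :=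
    ((contDiffAt_fromSlit hw).differentiableAt (by simp)).hasFDerivAt
  have hinv (w : EE m) (hw : w ∉ R0 m) (u : EE m) :
      fderiv ℝ toSlit (fromSlit w) (fderiv ℝ fromSlit w u) = u := by
    have h1 := (hdiff (fromSlit w)).hasFDerivAt.comp w (hfrom w hw)
    have h2 : HasFDerivAt (toSlit ∘ fromSlit) (ContinuousLinearMap.id ℝ (EE m)) w :=
      (hasFDerivAt_id w).congr_of_eventuallyEq ((hopen w hw).mono fun w' hw' => toSlit_fromSlit hw')
    exact congrArg (fun L => L u) (h1.unique h2)
  have hφsmooth (z : EE m) (hz : z ∉ R0 m) :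
      ContDiffAt ℝ (⊤ : ℕ∞) (fun z : EE m => fromSlit (toSlit z + e)) z :=
    ContDiffAt.comp (g := fromSlit) z (contDiffAt_fromSlit (hnot1 z hz))
      (contDiff_toSlit.contDiffAt.add contDiffAt_const)
  have hback (w : EE m) : toSlit w - e ∉ R0 m := fun h => hB w <| by
    simpa using mono _ 1 zero_le_one h
  have hψsmooth : ContDiff ℝ (⊤ : ℕ∞) (fun w : EE m => fromSlit (toSlit w - e)) :=
    contDiff_iff_contDiffAt.2 fun w => ContDiffAt.comp (g := fromSlit) w
      (contDiffAt_fromSlit (hback w)) (contDiff_toSlit.contDiffAt.sub contDiffAt_const)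
  have hinvOn : InvOn (fun w : EE m => fromSlit (toSlit w - e))
      (fun z : EE m => fromSlit (toSlit z + e)) (R0 m)ᶜ univ := by
    refine ⟨fun z hz => ?_, fun w _ => ?_⟩
    · simp only
      rw [toSlit_fromSlit (hnot1 z hz), add_sub_cancel_right, fromSlit_toSlit]
    · simp only
      rw [toSlit_fromSlit (hback w), sub_add_cancel, fromSlit_toSlit]
  have hmaps : MapsTo (fun w : EE m => fromSlit (toSlit w - e)) univ (R0 m)ᶜ := fun w _ hw =>
    hB w <| by
      have := (toSlit_add_mem_iff _).2 hw
      rwa [toSlit_fromSlit (hback w), ← he, sub_add_cancel] at this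
  refine ⟨fun z => (toSlit z).2.2, contDiff_toSlit.snd.snd,
    fun z => fderiv ℝ fromSlit (toSlit z) e, ?_, ?_, fun z => fromSlit (toSlit z + e),
    ?_, ?_, ?_, ?_, ?_⟩
  · intro z w
    have h1 := hinv _ (hB z) e
    rw [fromSlit_toSlit] at h1
    rw [← wcan_fderiv_toSlit z, h1]
    have h2 : HasFDerivAt (fun z : EE m => (toSlit z).2.2) _ z := (hdiff z).hasFDerivAt.snd.snd
    rw [h2.fderiv]
    simp [wcan, wB, he]
  · intro γ T _ h0 hγ t ht
    have hd : ∀ s ∈ Icc 0 T, HasDerivAt (fun s => toSlit (γ s) - s • e) 0 s := fun s hs => by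
      have h1 := (hdiff (γ s)).hasFDerivAt.comp_hasDerivAt s (hγ s hs)
      have h2 := hinv _ (hB (γ s)) e
      rw [fromSlit_toSlit] at h2
      rw [h2] at h1
      exact (h1.fun_sub ((hasDerivAt_id s).smul_const e)).congr_deriv (by simp)
    have hconst := constant_of_has_deriv_right_zero
      (fun s hs => (hd s hs).continuousAt.continuousWithinAt)
      (fun s hs => (hd s (Ico_subset_Icc_self hs)).hasDerivWithinAt) t ht
    have hγt : toSlit (γ t) = toSlit (γ 0) + t • e := by
      simpa [sub_eq_iff_eq_add] using hconst
    rw [← toSlit_add_mem_iff, hγt, add_right_comm]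
    exact mono _ t ht.1 ((toSlit_add_mem_iff _).2 h0)
  · intro z hz
    refine ⟨fun t => fromSlit (toSlit z + t • e), by simp [fromSlit_toSlit], fun t ht => ?_,
      by simp⟩
    have hw := hnot z hz t ht.2
    have h1 : HasDerivAt (fun t : ℝ => toSlit z + t • e) e t := by
      simpa using ((hasDerivAt_id t).smul_const e).const_add (toSlit z)
    simp only
    rw [toSlit_fromSlit hw]
    exact (hfrom _ hw).comp_hasDerivAt t h1
  · exact fun z hz => (hφsmooth z hz).contDiffWithinAt
  · exact hinvOn.bijOn (mapsTo_univ _ _) hmaps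
  · exact ⟨fun w => fromSlit (toSlit w - e), hψsmooth, hinvOn⟩
  · intro z hz u v
    have hz1 := hnot1 z hz
    have key (u : EE m) : fderiv ℝ toSlit (fromSlit (toSlit z + e))
        (fderiv ℝ (fun z : EE m => fromSlit (toSlit z + e)) z u) = fderiv ℝ toSlit z u := by
      have h1 := (hdiff (fromSlit (toSlit z + e))).hasFDerivAt.comp z
        ((hφsmooth z hz).differentiableAt (by simp)).hasFDerivAt
      have h2 : HasFDerivAt (toSlit ∘ fun z : EE m => fromSlit (toSlit z + e))
          (fderiv ℝ toSlit z) z :=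
        ((hdiff z).hasFDerivAt.add_const e).congr_of_eventuallyEq
          ((hopen z hz).mono fun w' hw' => toSlit_fromSlit (hnot1 w' hw'))
      exact congrArg (fun L => L u) (h1.unique h2)
    rw [← wcan_fderiv_toSlit (fromSlit (toSlit z + e)), key, key, wcan_fderiv_toSlit]
end
end

section
/- Let ω be a symplectic form on ℝ^{2n} and let γ : [0,∞) → ℝ^{2n} be a proper smooth embedding (γ is smooth, injective, proper, and γ'(t) ≠ 0 for all t), with image R = γ([0,∞)). Then R is time-independent Hamiltonian excisable from (ℝ^{2n}, ω): there exists a smooth F : ℝ^{2n} → ℝ such that every forward trajectory of the flow of the Hamiltonian vector field X_F (defined by ω_z(X_F(z), ·) = dF_z) that starts in R stays in R as long as it is defined, the maximal integral curve of X_F starting at any z ∈ ℝ^{2n} ∖ R is defined at least on [0,1], and the time-1 flow map of X_F is a diffeomorphism from ℝ^{2n} ∖ R onto ℝ^{2n} whose derivative preserves ω, i.e., ω_{φ(z)}(Dφ_z u, Dφ_z v) = ω_z(u,v) for all z, u, v. -/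
open Set

noncomputable section

section SmoothExtension

open Filter Topology
open scoped ContDiff

variable {E : Type*} [NormedAddCommGroup E] [NormedSpace ℝ E]

/-- A function which starts a sequence of successive derivatives is smooth. -/
theorem contDiff_infty_of_hasDerivAt_seq {D : ℕ → ℝ → E}
    (hD : ∀ n t, HasDerivAt (D n) (D (n + 1) t) t) : ContDiff ℝ ∞ (D 0) := by
  have key : ∀ n, iteratedDeriv n (D 0) = D n := by
    intro n
    induction n with
    | zero => simp
    | succ n ih => rw [iteratedDeriv_succ, ih]; exact funext fun t => (hD n t).deriv
  exact contDiff_of_differentiable_iteratedDeriv fun m _ => by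
    rw [key m]; exact fun t => (hD m t).differentiableAt

/-- A compactly supported version of the monomial `x ^ k / k!`. -/
def cutMonomial (k : ℕ) (x : ℝ) : ℝ :=
  (⟨1, 2, one_pos, one_lt_two⟩ : ContDiffBump (0 : ℝ)) x * (x ^ k / k.factorial)

theorem contDiff_cutMonomial (k : ℕ) : ContDiff ℝ ∞ (cutMonomial k) :=
  (ContDiffBump.contDiff _).mul ((contDiff_id.pow k).div_const _)

theorem hasCompactSupport_cutMonomial (k : ℕ) : HasCompactSupport (cutMonomial k) :=
  (ContDiffBump.hasCompactSupport _).mul_right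

theorem iteratedDeriv_cutMonomial_zero (k n : ℕ) :
    iteratedDeriv n (cutMonomial k) 0 = if n = k then 1 else 0 := by
  have h : cutMonomial k =ᶠ[𝓝 0] fun x => x ^ k / k.factorial := by
    filter_upwards [(⟨1, 2, one_pos, one_lt_two⟩ : ContDiffBump (0 : ℝ)).eventuallyEq_one]
      with x hx
    simp [cutMonomial, hx]
  rw [h.iteratedDeriv_eq n]
  simp only [div_eq_inv_mul]
  rw [iteratedDeriv_const_mul_field, iteratedDeriv_fun_pow_zero]
  by_cases h : n = k
  · subst h
    simp [Nat.factorial_ne_zero]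
  · simp [h]

theorem exists_bound_iteratedDeriv_cutMonomial (k n : ℕ) :
    ∃ C, ∀ x, ‖iteratedDeriv n (cutMonomial k) x‖ ≤ C := by
  have hc : HasCompactSupport (iteratedDeriv n (cutMonomial k)) := by
    induction n with
    | zero => simpa using hasCompactSupport_cutMonomial k
    | succ n ih => rw [iteratedDeriv_succ]; exact ih.deriv
  exact ((contDiff_cutMonomial k).continuous_iteratedDeriv n
    (by exact_mod_cast le_top)).bounded_above_of_compact_support hc

/-- **Borel's lemma**: every sequence is the sequence of derivatives at `0` of a smooth
function. -/
theorem exists_hasDerivAt_seq_eq [CompleteSpace E] (a : ℕ → E) :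
    ∃ D : ℕ → ℝ → E, (∀ n t, HasDerivAt (D n) (D (n + 1) t) t) ∧ ∀ n, D n 0 = a n := by
  choose C hC using exists_bound_iteratedDeriv_cutMonomial
  have hC0 : ∀ k n, 0 ≤ C k n := fun k n => (norm_nonneg _).trans (hC k n 0)
  set l : ℕ → ℝ := fun k => 1 + 2 ^ k * ∑ n ∈ Finset.range k, C k n * ‖a k‖ with hl
  have hl1 : ∀ k, 1 ≤ l k := fun k => by
    have : 0 ≤ ∑ n ∈ Finset.range k, C k n * ‖a k‖ :=
      Finset.sum_nonneg fun n _ => mul_nonneg (hC0 k n) (norm_nonneg _)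
    simp only [hl]
    nlinarith [mul_nonneg (pow_nonneg zero_le_two k : (0 : ℝ) ≤ 2 ^ k) this]
  have hl0 : ∀ k, 0 < l k := fun k => one_pos.trans_le (hl1 k)
  let d : ℕ → ℕ → ℝ → E := fun n k x =>
    (l k ^ n / l k ^ k * iteratedDeriv n (cutMonomial k) (l k * x)) • a k
  have hd : ∀ n k x, HasDerivAt (d n k) (d (n + 1) k x) x := by
    intro n k x
    have h1 : HasDerivAt (iteratedDeriv n (cutMonomial k))
        (iteratedDeriv (n + 1) (cutMonomial k) (l k * x)) (l k * x) := by
      rw [iteratedDeriv_succ]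
      exact (((contDiff_cutMonomial k).differentiable_iteratedDeriv n
        (by exact_mod_cast WithTop.coe_lt_top _)) _).hasDerivAt
    have h2 : HasDerivAt (fun x => l k * x) (l k) x := by
      simpa using (hasDerivAt_id x).const_mul (l k)
    have h3 := ((h1.comp x h2).const_mul (l k ^ n / l k ^ k)).smul_const (a k)
    refine HasDerivAt.congr_deriv h3 ?_
    change _ = (l k ^ (n + 1) / l k ^ k * iteratedDeriv (n + 1) (cutMonomial k) (l k * x)) • a k
    congr 1
    ring
  let u : ℕ → ℕ → ℝ := fun n k =>
    if k ≤ n then l k ^ n / l k ^ k * C k n * ‖a k‖ else (1 / 2) ^ k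
  have hdu : ∀ n k x, ‖d n k x‖ ≤ u n k := by
    intro n k x
    have h1 : ‖d n k x‖ ≤ l k ^ n / l k ^ k * C k n * ‖a k‖ := by
      simp only [d, norm_smul, norm_mul]
      have h2 : ‖l k ^ n / l k ^ k‖ = l k ^ n / l k ^ k :=
        Real.norm_of_nonneg (div_nonneg (pow_nonneg (hl0 k).le _) (pow_nonneg (hl0 k).le _))
      rw [h2]
      gcongr
      · exact div_nonneg (pow_nonneg (hl0 k).le _) (pow_nonneg (hl0 k).le _)
      · exact hC k n _
    by_cases hk : k ≤ n
    · simpa [u, hk] using h1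
    · simp only [u, hk, if_false]
      push Not at hk
      refine h1.trans ?_
      have h4 : C k n * ‖a k‖ ≤ ∑ n ∈ Finset.range k, C k n * ‖a k‖ :=
        Finset.single_le_sum (f := fun n => C k n * ‖a k‖)
          (fun n _ => mul_nonneg (hC0 k n) (norm_nonneg _)) (Finset.mem_range.2 hk)
      have h5 : l k ^ n / l k ^ k ≤ 1 / l k := by
        rw [div_le_div_iff₀ (pow_pos (hl0 k) _) (hl0 k), one_mul, ← pow_succ]
        exact pow_le_pow_right₀ (hl1 k) hk
      have h6 : 2 ^ k * (C k n * ‖a k‖) ≤ l k := by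
        have := mul_le_mul_of_nonneg_left h4 (pow_nonneg zero_le_two k : (0 : ℝ) ≤ 2 ^ k)
        simp only [hl]
        linarith
      have h7 : 0 ≤ C k n * ‖a k‖ := mul_nonneg (hC0 k n) (norm_nonneg _)
      calc l k ^ n / l k ^ k * C k n * ‖a k‖ = l k ^ n / l k ^ k * (C k n * ‖a k‖) := by ring
        _ ≤ 1 / l k * (C k n * ‖a k‖) := by gcongr
        _ ≤ (1 / 2) ^ k := by
          rw [one_div_mul_eq_div, div_le_iff₀ (hl0 k), one_div, inv_pow,
            ← div_eq_inv_mul, le_div_iff₀ (by positivity)]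
          linarith
  have hu : ∀ n, Summable (u n) := fun n => by
    refine (summable_geometric_of_lt_one (by norm_num) (by norm_num : (1 / 2 : ℝ) < 1)).congr_cofinite
      ?_
    rw [Nat.cofinite_eq_atTop]
    filter_upwards [eventually_gt_atTop n] with k hk
    simp [u, not_le.2 hk]
  refine ⟨fun n x => ∑' k, d n k x, fun n t => ?_, fun n => ?_⟩
  · exact hasDerivAt_tsum (hu (n + 1)) (hd n) (hdu (n + 1))
      (y₀ := 0) (Summable.of_norm_bounded (hu n) fun k => hdu n k 0) t
  · have h1 : ∀ k, k ≠ n → d n k 0 = 0 := fun k hk => by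
      simp [d, iteratedDeriv_cutMonomial_zero, hk.symm]
    refine (tsum_eq_single n h1).trans ?_
    simp [d, iteratedDeriv_cutMonomial_zero, (hl0 n).ne']

/-- A function which is smooth on a closed half-line, up to its endpoint, extends to a smooth
function on the line. -/
theorem ContDiffOn.exists_contDiff_eqOn_Ici [CompleteSpace E] {f : ℝ → E}
    (hf : ContDiffOn ℝ ∞ f (Ici 0)) : ∃ g : ℝ → E, ContDiff ℝ ∞ g ∧ EqOn g f (Ici 0) := by
  obtain ⟨D, hD, hD0⟩ := exists_hasDerivAt_seq_eq fun n => iteratedDerivWithin n f (Ici 0) 0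
  let G : ℕ → ℝ → E := fun n t => if 0 ≤ t then iteratedDerivWithin n f (Ici 0) t else D n t
  have hR : ∀ n, ∀ t ∈ Ici (0 : ℝ), HasDerivWithinAt (iteratedDerivWithin n f (Ici 0))
      (iteratedDerivWithin (n + 1) f (Ici 0) t) (Ici 0) t := fun n t ht => by
    rw [iteratedDerivWithin_succ]
    exact (hf.differentiableOn_iteratedDerivWithin (by exact_mod_cast WithTop.coe_lt_top _)
      (uniqueDiffOn_Ici 0) t ht).hasDerivWithinAt
  have hGI : ∀ n, EqOn (G n) (iteratedDerivWithin n f (Ici 0)) (Ici 0) := fun n t ht => if_pos ht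
  have hGD : ∀ n, EqOn (G n) (D n) (Iic 0) := fun n t ht => by
    rcases eq_or_lt_of_le (show t ≤ 0 from ht) with rfl | h
    · simp [G, hD0]
    · simp [G, not_le.2 h]
  have hG : ∀ n t, HasDerivAt (G n) (G (n + 1) t) t := by
    intro n t
    have hr : ∀ t ∈ Ici (0 : ℝ), HasDerivWithinAt (G n) (G (n + 1) t) (Ici 0) t := fun t ht => by
      rw [hGI _ ht]
      exact (hR n t ht).congr (hGI n) (hGI n ht)
    have hl : ∀ t ∈ Iic (0 : ℝ), HasDerivWithinAt (G n) (G (n + 1) t) (Iic 0) t := fun t ht => by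
      rw [hGD _ ht]
      exact (hD n t).hasDerivWithinAt.congr (hGD n) (hGD n ht)
    rcases lt_trichotomy t 0 with h | rfl | h
    · exact (hl t h.le).hasDerivAt (Iic_mem_nhds h)
    · have := (hl 0 self_mem_Iic).union (hr 0 self_mem_Ici)
      rwa [Iic_union_Ici, hasDerivWithinAt_univ] at this
    · exact (hr t h.le).hasDerivAt (Ici_mem_nhds h)
  refine ⟨G 0, contDiff_infty_of_hasDerivAt_seq hG, fun t ht => ?_⟩
  rw [hGI 0 ht, iteratedDerivWithin_zero]

end SmoothExtension

section Flow

open Filter Topology Metric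
open scoped ContDiff NNReal

variable {E : Type*} [NormedAddCommGroup E] [NormedSpace ℝ E]

/-- `c` is an integral curve of the vector field `X` over the time interval `[0, T]`. -/
def SolvesOn (X : E → E) (T : ℝ) (c : ℝ → E) : Prop :=
  ∀ t ∈ Icc 0 T, HasDerivAt c (X (c t)) t

namespace SolvesOn

variable {X Y : E → E} {S T : ℝ} {c c₁ c₂ : ℝ → E}

theorem mono (h : SolvesOn X T c) (hS : S ≤ T) : SolvesOn X S c :=
  fun t ht => h t ⟨ht.1, ht.2.trans hS⟩

theorem continuousOn (h : SolvesOn X T c) : ContinuousOn c (Icc 0 T) :=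
  fun t ht => (h t ht).continuousAt.continuousWithinAt

theorem congr (h : SolvesOn X T c) (hXY : ∀ t ∈ Icc 0 T, X (c t) = Y (c t)) : SolvesOn Y T c :=
  fun t ht => hXY t ht ▸ h t ht

/-- Time reversal of an integral curve. -/
theorem reverse (h : SolvesOn X T c) : SolvesOn (fun z => -X z) T (fun t => c (T - t)) := by
  intro t ht
  have h1 := h (T - t) ⟨by linarith [ht.2], by linarith [ht.1]⟩
  simpa using h1.comp_const_sub T t

theorem eqOn (hX : ContDiff ℝ ∞ X) (h₁ : SolvesOn X T c₁) (h₂ : SolvesOn X T c₂)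
    (h0 : c₁ 0 = c₂ 0) : EqOn c₁ c₂ (Icc 0 T) := by
  have hK : IsCompact (c₁ '' Icc 0 T ∪ c₂ '' Icc 0 T) :=
    (isCompact_Icc.image_of_continuousOn h₁.continuousOn).union
      (isCompact_Icc.image_of_continuousOn h₂.continuousOn)
  obtain ⟨K, hL⟩ := LocallyLipschitzOn.exists_lipschitzOnWith_of_compact hK
    (hX.of_le (by simp) : ContDiff ℝ 1 X).locallyLipschitz.locallyLipschitzOn
  exact ODE_solution_unique_of_mem_Icc_right (v := fun _ => X) (s := fun _ => _)
    (fun _ _ => hL) h₁.continuousOn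
    (fun t ht => (h₁ t (Ico_subset_Icc_self ht)).hasDerivWithinAt)
    (fun t ht => Or.inl (mem_image_of_mem _ (Ico_subset_Icc_self ht))) h₂.continuousOn
    (fun t ht => (h₂ t (Ico_subset_Icc_self ht)).hasDerivWithinAt)
    (fun t ht => Or.inr (mem_image_of_mem _ (Ico_subset_Icc_self ht))) h0

end SolvesOn

variable [FiniteDimensional ℝ E] {X : E → E} {T : ℝ}

/-- Compactly supported vector fields are complete. -/
theorem exists_solvesOn_of_hasCompactSupport (hX : ContDiff ℝ ∞ X) (hc : HasCompactSupport X)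
    (T : ℝ) (z : E) : ∃ c, c 0 = z ∧ SolvesOn X T c := by
  rcases lt_or_ge T 0 with hT | hT
  · exact ⟨fun _ => z, rfl, fun t ht => absurd (ht.1.trans ht.2) (not_le.2 hT)⟩
  obtain ⟨M, hM⟩ := hX.continuous.bounded_above_of_compact_support hc
  obtain ⟨K, hK⟩ := ContDiff.lipschitzWith_of_hasCompactSupport (n := ∞) (𝕂 := ℝ) hc hX (by simp)
  have hM0 : 0 ≤ M := (norm_nonneg _).trans (hM z)
  have h0 : (0 : ℝ) ∈ Icc (-1) (T + 1) := ⟨by norm_num, by linarith⟩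
  obtain ⟨c, hc0, hc⟩ := IsPicardLindelof.exists_eq_forall_mem_Icc_hasDerivWithinAt₀
    (IsPicardLindelof.of_time_independent (f := X) (tmin := -1) (tmax := T + 1) (t₀ := ⟨0, h0⟩)
      (x₀ := z) (a := ⟨M * (T + 1), by positivity⟩) (r := 0) (L := ⟨M, hM0⟩) (K := K)
      (fun x _ => hM x) hK.lipschitzOnWith (by
        simp only [NNReal.coe_zero, sub_zero, zero_sub, neg_neg]
        rw [max_eq_left (by linarith)]
        exact le_rfl))
  exact ⟨c, hc0, fun t ht => (hc t ⟨by linarith [ht.1], by linarith [ht.2]⟩).hasDerivAt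
    (Icc_mem_nhds (by linarith [ht.1]) (by linarith [ht.2]))⟩

/-- A smooth vector field can be cut off outside any given ball. -/
theorem exists_hasCompactSupport_eqOn_closedBall (hX : ContDiff ℝ ∞ X) (R : ℝ) :
    ∃ Y : E → E, ContDiff ℝ ∞ Y ∧ HasCompactSupport Y ∧ ∀ z, ‖z‖ ≤ R → Y z = X z := by
  let b : ContDiffBump (0 : E) := ⟨|R| + 1, |R| + 2, by positivity, by linarith⟩
  refine ⟨fun z => b z • X z, b.contDiff.smul hX, b.hasCompactSupport.smul_right, fun z hz => ?_⟩
  have : b z = 1 := b.one_of_mem_closedBall (by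
    rw [mem_closedBall_zero_iff]
    change ‖z‖ ≤ |R| + 1
    linarith [le_abs_self R])
  simp [this]

/-- An integral curve exists up to time `T` if there is an a priori bound for it. -/
theorem exists_solvesOn_of_bound (hX : ContDiff ℝ ∞ X) {R : ℝ} {z : E} (hT : 0 ≤ T)
    (hR : ∀ S ∈ Icc 0 T, ∀ c, c 0 = z → SolvesOn X S c → ‖c S‖ ≤ R) :
    ∃ c, c 0 = z ∧ SolvesOn X T c := by
  obtain ⟨Y, hY, hYc, hYX⟩ := exists_hasCompactSupport_eqOn_closedBall hX (R + 1)
  obtain ⟨c, hc0, hc⟩ := exists_solvesOn_of_hasCompactSupport hY hYc T z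
  have step : ∀ S ∈ Icc 0 T, (∀ t ∈ Icc 0 S, ‖c t‖ ≤ R + 1) → ‖c S‖ ≤ R := fun S hS h =>
    hR S hS c hc0 ((hc.mono hS.2).congr fun t ht => hYX _ (h t ht))
  have hn : ContinuousOn (fun t => ‖c t‖) (Icc 0 T) := hc.continuousOn.norm
  refine ⟨c, hc0, hc.congr fun t ht => hYX _ ?_⟩
  by_contra! hlt
  have hA : IsCompact (Icc 0 T ∩ (fun t => ‖c t‖) ⁻¹' Ici (R + 1)) :=
    isCompact_Icc.of_isClosed_subset (hn.preimage_isClosed_of_isClosed isClosed_Icc isClosed_Ici)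
      inter_subset_left
  obtain ⟨s, ⟨hs, hsR⟩, hsl⟩ := hA.exists_isLeast ⟨t, ht, hlt.le⟩
  have hlt' : ∀ u ∈ Icc 0 T, u < s → ‖c u‖ < R + 1 := fun u hu hus => by
    by_contra! h
    exact absurd (hsl ⟨hu, h⟩) (not_le.2 hus)
  have h0 : ‖c 0‖ ≤ R := by
    have := hR 0 ⟨le_rfl, hT⟩ (fun t => z + t • X z) (by simp) fun t ht => by
      obtain rfl : t = 0 := le_antisymm ht.2 ht.1
      simpa using ((hasDerivAt_id (0 : ℝ)).smul_const (X z)).const_add z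
    simpa [hc0] using this
  obtain ⟨u, hu, huR⟩ := intermediate_value_Icc hs.1 (hn.mono (Icc_subset_Icc_right hs.2))
    (show R + 1 / 2 ∈ Icc _ _ from ⟨by linarith, by have : R + 1 ≤ ‖c s‖ := hsR; linarith⟩)
  have hus : u < s := lt_of_le_of_ne hu.2 fun h => by
    rw [h] at huR
    have : R + 1 ≤ ‖c s‖ := hsR
    linarith
  have := step u ⟨hu.1, hu.2.trans hs.2⟩ fun t ht =>
    (hlt' t ⟨ht.1, ht.2.trans (hu.2.trans hs.2)⟩ (ht.2.trans_lt hus)).le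
  linarith

/-- Integral curves exist, and depend Lipschitz continuously on the initial value, near a given
integral curve. -/
theorem SolvesOn.exists_near (hX : ContDiff ℝ ∞ X) {c₀ : ℝ → E}
    (h₀ : SolvesOn X T c₀) : ∃ C, ∀ᶠ z in 𝓝 (c₀ 0), ∃ c, c 0 = z ∧ SolvesOn X T c ∧
      ∀ t ∈ Icc 0 T, ‖c t - c₀ t‖ ≤ C * ‖z - c₀ 0‖ := by
  obtain ⟨R, hR⟩ := isCompact_Icc.exists_bound_of_continuousOn h₀.continuousOn
  obtain ⟨Y, hY, hYc, hYX⟩ := exists_hasCompactSupport_eqOn_closedBall hX (R + 1)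
  obtain ⟨K, hK⟩ := ContDiff.lipschitzWith_of_hasCompactSupport (n := ∞) (𝕂 := ℝ) hYc hY (by simp)
  have h₀' : SolvesOn Y T c₀ := h₀.congr fun t ht => (hYX _ (by linarith [hR t ht])).symm
  refine ⟨Real.exp (K * T), ?_⟩
  filter_upwards [ball_mem_nhds (c₀ 0) (Real.exp_pos (-(K * T)))] with z hz
  obtain ⟨c, hc0, hc⟩ := exists_solvesOn_of_hasCompactSupport hY hYc T z
  have key : ∀ t ∈ Icc 0 T, ‖c t - c₀ t‖ ≤ Real.exp (K * T) * ‖z - c₀ 0‖ := fun t ht => by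
    have := dist_le_of_trajectories_ODE (v := fun _ => Y) (fun _ => hK) hc.continuousOn
      (fun t ht => (hc t (Ico_subset_Icc_self ht)).hasDerivWithinAt) h₀'.continuousOn
      (fun t ht => (h₀' t (Ico_subset_Icc_self ht)).hasDerivWithinAt) le_rfl t ht
    rw [dist_eq_norm, dist_eq_norm, hc0, sub_zero, mul_comm] at this
    refine this.trans ?_
    gcongr
    exact ht.2
  refine ⟨c, hc0, hc.congr fun t ht => hYX _ ?_, key⟩
  rw [mem_ball, dist_eq_norm] at hz
  have h1 : Real.exp (K * T) * ‖z - c₀ 0‖ ≤ 1 := by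
    rw [Real.exp_neg] at hz
    rw [← le_inv_mul_iff₀ (Real.exp_pos _), mul_one]
    exact hz.le
  have h2 : ‖c t‖ ≤ ‖c t - c₀ t‖ + ‖c₀ t‖ := by simpa using norm_add_le (c t - c₀ t) (c₀ t)
  linarith [key t ht, hR t ht]

/-- A smooth map is differentiable uniformly along a bounded curve. -/
theorem exists_uniform_linear_approx (hX : ContDiff ℝ ∞ X) (R : ℝ) {ε : ℝ}
    (hε : 0 < ε) : ∃ δ > 0, ∀ a, ‖a‖ ≤ R → ∀ w, ‖w - a‖ < δ →
      ‖X w - X a - fderiv ℝ X a (w - a)‖ ≤ ε * ‖w - a‖ := by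
  have huc : UniformContinuousOn (fderiv ℝ X) (closedBall 0 (R + 1)) :=
    (isCompact_closedBall _ _).uniformContinuousOn_of_continuous
      (hX.continuous_fderiv (by simp)).continuousOn
  obtain ⟨δ, hδ, h⟩ := Metric.uniformContinuousOn_iff.1 huc ε hε
  refine ⟨min δ 1, lt_min hδ one_pos, fun a ha w hw => ?_⟩
  refine Convex.norm_image_sub_le_of_norm_fderiv_le' (s := ball a (min δ 1)) (𝕜 := ℝ)
    (fun x _ => (hX.differentiable (by simp)) x) (fun x hx => ?_) (convex_ball _ _)
    (mem_ball_self (lt_min hδ one_pos)) (by rwa [mem_ball, dist_eq_norm])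
  rw [← dist_eq_norm]
  have hx1 : dist x a < 1 := hx.trans_le (min_le_right _ _)
  refine (h x ?_ a ?_ (hx.trans_le (min_le_left _ _))).le
  · rw [mem_closedBall_zero_iff]
    rw [dist_eq_norm] at hx1
    have h2 : ‖x‖ ≤ ‖x - a‖ + ‖a‖ := by simpa using norm_add_le (x - a) a
    linarith
  · rw [mem_closedBall_zero_iff]
    linarith

/-- The variational equation along an integral curve has a fundamental solution. -/
theorem SolvesOn.exists_variational (hX : ContDiff ℝ ∞ X) {c : ℝ → E} (hT : 0 ≤ T)
    (hc : SolvesOn X T c) : ∃ J : ℝ → E →L[ℝ] E, J 0 = ContinuousLinearMap.id ℝ E ∧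
      ∀ t ∈ Icc 0 T, HasDerivAt J ((fderiv ℝ X (c t)).comp (J t)) t := by
  obtain ⟨R, hR⟩ := isCompact_Icc.exists_bound_of_continuousOn hc.continuousOn
  have hdX : ContDiff ℝ ∞ (fderiv ℝ X) := hX.fderiv_right (by simp)
  obtain ⟨M, hM⟩ := isCompact_Icc.exists_bound_of_continuousOn
    (hdX.continuous.comp_continuousOn hc.continuousOn)
  let Z : E × (E →L[ℝ] E) → E × (E →L[ℝ] E) := fun p => (X p.1, (fderiv ℝ X p.1).comp p.2)
  have hZ : ContDiff ℝ ∞ Z :=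
    (hX.comp contDiff_fst).prodMk ((hdX.comp contDiff_fst).clm_comp contDiff_snd)
  have hfst : ∀ {S b}, SolvesOn Z S b → SolvesOn X S (fun t => (b t).1) := fun hb t ht =>
    (ContinuousLinearMap.fst ℝ E (E →L[ℝ] E)).hasFDerivAt.comp_hasDerivAt t (hb t ht)
  have hsnd : ∀ {S b}, SolvesOn Z S b → ∀ t ∈ Icc 0 S, HasDerivAt (fun t => (b t).2)
      ((fderiv ℝ X (b t).1).comp (b t).2) t := fun hb t ht =>
    (ContinuousLinearMap.snd ℝ E (E →L[ℝ] E)).hasFDerivAt.comp_hasDerivAt t (hb t ht)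
  have heq : ∀ {S b}, S ≤ T → SolvesOn Z S b → b 0 = (c 0, ContinuousLinearMap.id ℝ E) →
      EqOn (fun t => (b t).1) c (Icc 0 S) := fun hS hb hb0 =>
    (hfst hb).eqOn hX (hc.mono hS) (by simp [hb0])
  have hbound : ∀ S ∈ Icc 0 T, ∀ b, b 0 = (c 0, ContinuousLinearMap.id ℝ E) → SolvesOn Z S b →
      ‖b S‖ ≤ max R (‖ContinuousLinearMap.id ℝ E‖ * Real.exp (M * T)) := by
    intro S hS b hb0 hb
    have h1 := heq hS.2 hb hb0
    have hM0 : 0 ≤ M := (norm_nonneg _).trans (hM 0 ⟨le_rfl, hT⟩)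
    have h2 := norm_le_gronwallBound_of_norm_deriv_right_le
      (f := fun t => (b t).2) (δ := ‖ContinuousLinearMap.id ℝ E‖) (K := M) (ε := 0)
      (fun t ht => (hsnd hb t ht).continuousAt.continuousWithinAt)
      (fun t ht => (hsnd hb t (Ico_subset_Icc_self ht)).hasDerivWithinAt) (by simp [hb0])
      (fun t ht => by
        rw [add_zero]
        refine (ContinuousLinearMap.opNorm_comp_le _ _).trans ?_
        gcongr
        rw [show (b t).1 = c t from h1 (Ico_subset_Icc_self ht)]
        exact hM t ⟨ht.1, ht.2.le.trans hS.2⟩) S ⟨hS.1, le_rfl⟩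
    rw [gronwallBound_ε0, sub_zero] at h2
    refine max_le_max ?_ (h2.trans ?_)
    · rw [show (b S).1 = c S from h1 ⟨hS.1, le_rfl⟩]
      exact hR S hS
    · gcongr
      exact hS.2
  obtain ⟨b, hb0, hb⟩ := exists_solvesOn_of_bound hZ hT hbound
  refine ⟨fun t => (b t).2, by simp [hb0], fun t ht => ?_⟩
  rw [← show (b t).1 = c t from heq le_rfl hb hb0 ht]
  exact hsnd hb t ht

/-- The fundamental solution of the variational equation is the derivative of the flow. -/
theorem hasFDerivAt_of_solvesOn (hX : ContDiff ℝ ∞ X) {U : Set E} (hU : IsOpen U) {Φ : E → ℝ → E}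
    (h0 : ∀ z ∈ U, Φ z 0 = z) (hΦ : ∀ z ∈ U, SolvesOn X T (Φ z)) {z₀ : E} (hz₀ : z₀ ∈ U)
    {J : ℝ → E →L[ℝ] E} (hJ0 : J 0 = ContinuousLinearMap.id ℝ E)
    (hJ : ∀ t ∈ Icc 0 T, HasDerivAt J ((fderiv ℝ X (Φ z₀ t)).comp (J t)) t)
    {t : ℝ} (ht : t ∈ Icc 0 T) : HasFDerivAt (fun z => Φ z t) (J t) z₀ := by
  obtain ⟨C, hC⟩ := (hΦ z₀ hz₀).exists_near hX
  rw [h0 z₀ hz₀] at hC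
  obtain ⟨R, hR⟩ := isCompact_Icc.exists_bound_of_continuousOn (hΦ z₀ hz₀).continuousOn
  have hdX : ContDiff ℝ ∞ (fderiv ℝ X) := hX.fderiv_right (by simp)
  obtain ⟨M, hM⟩ := isCompact_Icc.exists_bound_of_continuousOn
    (hdX.continuous.comp_continuousOn (hΦ z₀ hz₀).continuousOn)
  have hM0 : 0 ≤ M := (norm_nonneg _).trans (hM t ht)
  rw [hasFDerivAt_iff_isLittleO, Asymptotics.isLittleO_iff]
  intro ε hε
  set D : ℝ := (|C| + 1) * Real.exp ((M + 1) * T) with hD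
  have hDpos : 0 < D := by positivity
  obtain ⟨δ, hδ, happ⟩ := exists_uniform_linear_approx hX R (div_pos hε hDpos)
  have hsmall : ∀ᶠ z in 𝓝 z₀, (|C| + 1) * ‖z - z₀‖ < δ := by
    have : Tendsto (fun z : E => (|C| + 1) * ‖z - z₀‖) (𝓝 z₀) (𝓝 ((|C| + 1) * ‖z₀ - z₀‖)) :=
      ((continuous_id.sub continuous_const).norm.const_mul _).tendsto _
    rw [sub_self, norm_zero, mul_zero] at this
    exact this.eventually_lt_const hδ
  filter_upwards [hC, hsmall, hU.mem_nhds hz₀] with z ⟨c, hc0, hc, hcC⟩ hzs hzU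
  have hnear : ∀ s ∈ Icc 0 T, ‖Φ z s - Φ z₀ s‖ ≤ (|C| + 1) * ‖z - z₀‖ := fun s hs => by
    rw [(hΦ z hzU).eqOn hX hc (by rw [h0 z hzU, hc0]) hs]
    refine (hcC s hs).trans ?_
    gcongr
    linarith [le_abs_self C]
  have hderiv : ∀ s ∈ Icc 0 T, HasDerivAt (fun s => Φ z s - Φ z₀ s - J s (z - z₀))
      (X (Φ z s) - X (Φ z₀ s) - fderiv ℝ X (Φ z₀ s) (J s (z - z₀))) s := fun s hs => by
    have h1 := (hJ s hs).clm_apply (hasDerivAt_const s (z - z₀))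
    have h2 : HasDerivAt (fun s => Φ z s - Φ z₀ s - J s (z - z₀)) _ s :=
      ((hΦ z hzU s hs).sub (hΦ z₀ hz₀ s hs)).sub h1
    rwa [map_zero, add_zero] at h2
  have key := norm_le_gronwallBound_of_norm_deriv_right_le
      (f := fun s => Φ z s - Φ z₀ s - J s (z - z₀)) (δ := 0) (K := M + 1)
      (ε := ε / D * ((|C| + 1) * ‖z - z₀‖))
      (fun s hs => (hderiv s hs).continuousAt.continuousWithinAt)
      (fun s hs => (hderiv s (Ico_subset_Icc_self hs)).hasDerivWithinAt)
      (by simp [h0 z hzU, h0 z₀ hz₀, hJ0])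
      (fun s hs => by
        have hs' := Ico_subset_Icc_self hs
        have e1 : X (Φ z s) - X (Φ z₀ s) - fderiv ℝ X (Φ z₀ s) (J s (z - z₀)) =
            fderiv ℝ X (Φ z₀ s) (Φ z s - Φ z₀ s - J s (z - z₀)) +
            (X (Φ z s) - X (Φ z₀ s) - fderiv ℝ X (Φ z₀ s) (Φ z s - Φ z₀ s)) := by
          rw [map_sub _ (Φ z s - Φ z₀ s) (J s (z - z₀))]; abel
        rw [e1]
        refine (norm_add_le _ _).trans (add_le_add ?_ ?_)
        · refine (ContinuousLinearMap.le_opNorm _ _).trans ?_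
          gcongr
          exact (hM s hs').trans (by linarith)
        · refine (happ _ (hR s hs') _ ((hnear s hs').trans_lt hzs)).trans ?_
          gcongr
          exact hnear s hs') t ht
  refine key.trans ?_
  rw [gronwallBound_of_K_ne_0 (by positivity)]
  simp only [zero_mul, zero_add, sub_zero]
  have h3 : ε / D * ((|C| + 1) * ‖z - z₀‖) / (M + 1) ≤ ε / D * ((|C| + 1) * ‖z - z₀‖) :=
    div_le_self (by positivity) (by linarith)
  have h4 : Real.exp ((M + 1) * t) - 1 ≤ Real.exp ((M + 1) * T) := by
    have : Real.exp ((M + 1) * t) ≤ Real.exp ((M + 1) * T) := by gcongr; exact ht.2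
    linarith
  calc _ ≤ ε / D * ((|C| + 1) * ‖z - z₀‖) * Real.exp ((M + 1) * T) :=
        mul_le_mul h3 h4 (by
          have : 1 ≤ Real.exp ((M + 1) * t) := Real.one_le_exp (mul_nonneg (by linarith) ht.1)
          linarith) (by positivity)
    _ = ε / D * D * ‖z - z₀‖ := by rw [hD]; ring
    _ = ε * ‖z - z₀‖ := by rw [div_mul_cancel₀ _ hDpos.ne']

end Flow

section FlowSmooth

open Filter Topology Metric
open scoped ContDiff NNReal

universe u

theorem contDiffOn_nat_of_solvesOn (k : ℕ) : ∀ {E : Type u} [NormedAddCommGroup E]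
    [NormedSpace ℝ E] [FiniteDimensional ℝ E] {X : E → E} {T : ℝ}, ContDiff ℝ ∞ X → 0 ≤ T →
    ∀ {U : Set E}, IsOpen U → ∀ {Φ : E → ℝ → E}, (∀ z ∈ U, Φ z 0 = z) →
    (∀ z ∈ U, SolvesOn X T (Φ z)) → ContDiffOn ℝ k (fun z => Φ z T) U := by
  induction k with
  | zero =>
    intro E _ _ _ X T hX hT U hU Φ h0 hΦ
    refine contDiffOn_zero.2 fun z₀ hz₀ => ContinuousAt.continuousWithinAt ?_
    obtain ⟨J, hJ0, hJ⟩ := (hΦ z₀ hz₀).exists_variational hX hT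
    exact (hasFDerivAt_of_solvesOn hX hU h0 hΦ hz₀ hJ0 hJ ⟨hT, le_rfl⟩).continuousAt
  | succ k ih =>
    intro E _ _ _ X T hX hT U hU Φ h0 hΦ
    have hJ : ∀ z, ∃ J : ℝ → E →L[ℝ] E, z ∈ U → J 0 = ContinuousLinearMap.id ℝ E ∧
        ∀ t ∈ Icc 0 T, HasDerivAt J ((fderiv ℝ X (Φ z t)).comp (J t)) t := fun z => by
      by_cases hz : z ∈ U
      · obtain ⟨J, hJ⟩ := (hΦ z hz).exists_variational hX hT
        exact ⟨J, fun _ => hJ⟩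
      · exact ⟨0, fun h => absurd h hz⟩
    choose J hJ using hJ
    have hder : ∀ z ∈ U, HasFDerivAt (fun z => Φ z T) (J z T) z := fun z hz =>
      hasFDerivAt_of_solvesOn hX hU h0 hΦ hz (hJ z hz).1 (hJ z hz).2 ⟨hT, le_rfl⟩
    rw [Nat.cast_add, Nat.cast_one, contDiffOn_succ_iff_fderiv_of_isOpen hU]
    refine ⟨fun z hz => (hder z hz).differentiableAt.differentiableWithinAt, by simp, ?_⟩
    refine ContDiffOn.congr (f := fun z => J z T) (contDiffOn_clm_apply.2 fun v => ?_)
      fun z hz => (hder z hz).fderiv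
    have hdX : ContDiff ℝ ∞ (fderiv ℝ X) := hX.fderiv_right (by simp)
    have := ih (E := E × E) (X := fun p => (X p.1, fderiv ℝ X p.1 p.2)) (T := T)
      (U := U ×ˢ univ) (Φ := fun p t => (Φ p.1 t, J p.1 t p.2))
      ((hX.comp contDiff_fst).prodMk ((hdX.comp contDiff_fst).clm_apply contDiff_snd)) hT
      (hU.prod isOpen_univ) (fun p hp => by simp [h0 _ hp.1, (hJ _ hp.1).1])
      (fun p hp t ht => (hΦ _ hp.1 t ht).prodMk (by
        simpa using ((hJ _ hp.1).2 t ht).clm_apply (hasDerivAt_const t p.2)))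
    exact contDiff_snd.comp_contDiffOn (this.comp (contDiff_id.prodMk contDiff_const).contDiffOn
      fun z hz => ⟨hz, mem_univ _⟩)

/-- The time-`T` map of the flow of a smooth vector field is smooth. -/
theorem contDiffOn_of_solvesOn {E : Type u} [NormedAddCommGroup E] [NormedSpace ℝ E]
    [FiniteDimensional ℝ E] {X : E → E} {T : ℝ} (hX : ContDiff ℝ ∞ X) (hT : 0 ≤ T) {U : Set E}
    (hU : IsOpen U) {Φ : E → ℝ → E} (h0 : ∀ z ∈ U, Φ z 0 = z)
    (hΦ : ∀ z ∈ U, SolvesOn X T (Φ z)) : ContDiffOn ℝ ∞ (fun z => Φ z T) U :=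
  contDiffOn_infty.2 fun k => contDiffOn_nat_of_solvesOn k hX hT hU h0 hΦ

end FlowSmooth

section Symplectic

open scoped ContDiff

variable {E : Type*} [NormedAddCommGroup E] [NormedSpace ℝ E]

/-- The linearized flow of a Hamiltonian vector field preserves the symplectic form. -/
theorem SolvesOn.symplectic {Ω : E → E →L[ℝ] E →L[ℝ] ℝ} (hΩ : ContDiff ℝ ∞ Ω)
    (halt : ∀ z u v, Ω z u v = -Ω z v u)
    (hclosed : ∀ z u v w,
      fderiv ℝ Ω z u v w + fderiv ℝ Ω z v w u + fderiv ℝ Ω z w u v = 0)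
    {F : E → ℝ} (hF : ContDiff ℝ ∞ F) {X : E → E} (hX : ContDiff ℝ ∞ X)
    (hXF : ∀ z w, Ω z (X z) w = fderiv ℝ F z w) {T : ℝ} {c : ℝ → E} (hc : SolvesOn X T c)
    {J : ℝ → E →L[ℝ] E} (hJ0 : J 0 = ContinuousLinearMap.id ℝ E)
    (hJ : ∀ t ∈ Icc 0 T, HasDerivAt J ((fderiv ℝ X (c t)).comp (J t)) t) {t : ℝ}
    (ht : t ∈ Icc 0 T) (u v : E) : Ω (c t) (J t u) (J t v) = Ω (c 0) u v := by
  have hdΩ : ∀ z, HasFDerivAt Ω (fderiv ℝ Ω z) z := fun z =>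
    (hΩ.differentiable (by simp) z).hasFDerivAt
  have hdX : ∀ z, HasFDerivAt X (fderiv ℝ X z) z := fun z =>
    (hX.differentiable (by simp) z).hasFDerivAt
  have hdF : ∀ z, HasFDerivAt (fderiv ℝ F) (fderiv ℝ (fderiv ℝ F) z) z := fun z =>
    ((hF.fderiv_right (m := ∞) (by simp)).differentiable (by simp) z).hasFDerivAt
  have hlin : ∀ z a b, fderiv ℝ Ω z a (X z) b + Ω z (fderiv ℝ X z a) b =
      fderiv ℝ (fderiv ℝ F) z a b := fun z a b => by
    have h1 := ((hdΩ z).clm_apply (hdX z)).clm_apply (hasFDerivAt_const b z)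
    have h2 := (hdF z).clm_apply (hasFDerivAt_const b z)
    have h3 : (fun z => Ω z (X z) b) = fun z => fderiv ℝ F z b := funext fun z => hXF z b
    rw [h3] at h1
    have := congrArg (fun L => L a) (h1.unique h2)
    simp at this
    linarith
  have hsymm : ∀ z a b, fderiv ℝ (fderiv ℝ F) z a b = fderiv ℝ (fderiv ℝ F) z b a :=
    fun z a b => ((contDiff_infty.1 hF 2).contDiffAt.isSymmSndFDerivAt (by simp)) a b
  have hdalt : ∀ z a u v, fderiv ℝ Ω z a u v = -fderiv ℝ Ω z a v u := fun z a u v => by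
    have h1 := ((hdΩ z).clm_apply (hasFDerivAt_const u z)).clm_apply (hasFDerivAt_const v z)
    have h2 := ((hdΩ z).clm_apply (hasFDerivAt_const v z)).clm_apply (hasFDerivAt_const u z)
    have h3 : (fun z => Ω z u v) = fun z => -Ω z v u := funext fun z => halt z u v
    rw [h3] at h1
    have := congrArg (fun L => L a) (h1.unique h2.neg)
    simpa using this
  have hder : ∀ s ∈ Icc 0 T, HasDerivAt (fun s => Ω (c s) (J s u) (J s v)) 0 s := fun s hs => by
    have h1 : HasDerivAt (fun s => Ω (c s)) (fderiv ℝ Ω (c s) (X (c s))) s :=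
      HasFDerivAt.comp_hasDerivAt (l := Ω) (f := c) s (hdΩ (c s)) (hc s hs)
    have hu := (hJ s hs).clm_apply (hasDerivAt_const s u)
    have hv := (hJ s hs).clm_apply (hasDerivAt_const s v)
    have h2 := (h1.clm_apply hu).clm_apply hv
    refine h2.congr_deriv ?_
    simp only [add_apply, map_zero, add_zero, ContinuousLinearMap.comp_apply]
    have e1 := hlin (c s) (J s u) (J s v)
    have e2 := hlin (c s) (J s v) (J s u)
    have e3 := hsymm (c s) (J s u) (J s v)
    have e4 := hclosed (c s) (X (c s)) (J s u) (J s v)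
    have e5 := hdalt (c s) (J s u) (X (c s)) (J s v)
    have e6 := halt (c s) (J s u) (fderiv ℝ X (c s) (J s v))
    linarith
  have := constant_of_has_deriv_right_zero
    (f := fun s => Ω (c s) (J s u) (J s v)) (a := 0) (b := T)
    (fun s hs => (hder s hs).continuousAt.continuousWithinAt)
    (fun s hs => (hder s (Ico_subset_Icc_self hs)).hasDerivWithinAt) t ht
  simpa [hJ0] using this

end Symplectic

section TimeOneMap

open scoped ContDiff

variable {E : Type*} [NormedAddCommGroup E] [NormedSpace ℝ E] [FiniteDimensional ℝ E]

/-- If exactly the trajectories of a Hamiltonian vector field that start outside the closed set `R`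
survive up to time one, and all trajectories extend backwards for time one, then the time-one map
is a symplectomorphism from the complement of `R` onto the whole space. -/
theorem exists_symplectic_timeOne_map {Ω : E → E →L[ℝ] E →L[ℝ] ℝ} (hΩ : ContDiff ℝ ∞ Ω)
    (halt : ∀ z u v, Ω z u v = -Ω z v u)
    (hclosed : ∀ z u v w,
      fderiv ℝ Ω z u v w + fderiv ℝ Ω z v w u + fderiv ℝ Ω z w u v = 0)
    {F : E → ℝ} (hF : ContDiff ℝ ∞ F) {X : E → E} (hX : ContDiff ℝ ∞ X)
    (hXF : ∀ z w, Ω z (X z) w = fderiv ℝ F z w) {R : Set E} (hR : IsClosed R)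
    (hforward : ∀ z ∉ R, ∃ c, c 0 = z ∧ SolvesOn X 1 c)
    (hescape : ∀ c, c 0 ∈ R → ¬ SolvesOn X 1 c)
    (hbackward : ∀ z, ∃ c, c 0 = z ∧ SolvesOn (fun z => -X z) 1 c) :
    ∃ φ : E → E, (∀ z ∉ R, ∃ c, c 0 = z ∧ SolvesOn X 1 c ∧ c 1 = φ z) ∧
      ContDiffOn ℝ ∞ φ Rᶜ ∧ BijOn φ Rᶜ univ ∧
      (∃ ψ, ContDiff ℝ ∞ ψ ∧ InvOn ψ φ Rᶜ univ) ∧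
      ∀ z ∉ R, ∀ u v, Ω (φ z) (fderiv ℝ φ z u) (fderiv ℝ φ z v) = Ω z u v := by
  have hforward' : ∀ z, ∃ c, z ∈ Rᶜ → c 0 = z ∧ SolvesOn X 1 c := fun z => by
    by_cases hz : z ∈ R
    · exact ⟨fun _ => z, fun h => absurd hz h⟩
    · obtain ⟨c, hc⟩ := hforward z hz
      exact ⟨c, fun _ => hc⟩
  choose Φ hΦ using hforward'
  choose Ψ hΨ using hbackward
  have hΨr : ∀ w, SolvesOn X 1 (fun t => Ψ w (1 - t)) := fun w => by
    simpa using (hΨ w).2.reverse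
  have h1 : (1 : ℝ) ∈ Icc (0 : ℝ) 1 := ⟨zero_le_one, le_rfl⟩
  have hmaps : ∀ w, Ψ w 1 ∈ Rᶜ := fun w hw => hescape _ (by simpa using hw) (hΨr w)
  have hleft : ∀ z ∈ Rᶜ, Ψ (Φ z 1) 1 = z := fun z hz => by
    rw [(hΨ _).2.eqOn hX.neg (hΦ z hz).2.reverse (by simp [(hΨ _).1]) h1]
    simp [(hΦ z hz).1]
  have hright : ∀ w, Φ (Ψ w 1) 1 = w := fun w => by
    rw [(hΦ _ (hmaps w)).2.eqOn hX (hΨr w) (by simp [(hΦ _ (hmaps w)).1]) h1]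
    simp [(hΨ w).1]
  have hinv : InvOn (fun z => Ψ z 1) (fun z => Φ z 1) Rᶜ univ := ⟨hleft, fun w _ => hright w⟩
  refine ⟨fun z => Φ z 1, fun z hz => ⟨Φ z, (hΦ z hz).1, (hΦ z hz).2, rfl⟩,
    contDiffOn_of_solvesOn hX zero_le_one hR.isOpen_compl (fun z hz => (hΦ z hz).1)
      fun z hz => (hΦ z hz).2,
    hinv.bijOn (mapsTo_univ _ _) fun w _ => hmaps w, ⟨fun z => Ψ z 1, ?_, hinv⟩, fun z hz u v => ?_⟩
  · exact contDiffOn_univ.1 (contDiffOn_of_solvesOn hX.neg zero_le_one isOpen_univ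
      (fun z _ => (hΨ z).1) fun z _ => (hΨ z).2)
  · obtain ⟨J, hJ0, hJ⟩ := (hΦ z hz).2.exists_variational hX zero_le_one
    rw [(hasFDerivAt_of_solvesOn hX hR.isOpen_compl (fun z hz => (hΦ z hz).1)
      (fun z hz => (hΦ z hz).2) hz hJ0 hJ h1).fderiv]
    have := (hΦ z hz).2.symplectic hΩ halt hclosed hF hX hXF hJ0 hJ h1 u v
    rwa [(hΦ z hz).1] at this

end TimeOneMap

section EmbeddedRay

open Filter Topology Metric
open scoped ContDiff Manifold

variable {E : Type*} [NormedAddCommGroup E]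

theorem isClosed_image_of_proper [ProperSpace E] {γ : ℝ → E} (hγ : Continuous γ) {a : ℝ}
    (hprop : ∀ K, IsCompact K → IsCompact {t | a ≤ t ∧ γ t ∈ K}) {S : Set ℝ} (hS : IsClosed S)
    (hSa : S ⊆ Ici a) : IsClosed (γ '' S) := by
  refine isClosed_of_closure_subset fun z hz => ?_
  have hC : IsCompact (γ '' ({t | a ≤ t ∧ γ t ∈ closedBall z 1} ∩ S)) :=
    ((hprop _ (isCompact_closedBall z 1)).inter_right hS).image hγ
  have hsub : z ∈ closure (γ '' ({t | a ≤ t ∧ γ t ∈ closedBall z 1} ∩ S)) := by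
    rw [mem_closure_iff_nhds] at hz ⊢
    intro V hV
    obtain ⟨w, ⟨hwV, hwB⟩, t, htS, rfl⟩ := hz _ (inter_mem hV (closedBall_mem_nhds z one_pos))
    exact ⟨γ t, hwV, t, ⟨⟨hSa htS, hwB⟩, htS⟩, rfl⟩
  rw [hC.isClosed.closure_eq] at hsub
  exact image_mono inter_subset_right hsub

variable [NormedSpace ℝ E]

/-- An immersed curve has local smooth left inverses. -/
theorem exists_contDiffOn_leftInverse_of_deriv_ne_zero {γ : ℝ → E} (hγ : ContDiff ℝ ∞ γ) {u₀ : ℝ}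
    (h : deriv γ u₀ ≠ 0) : ∃ V ∈ 𝓝 (γ u₀), ∃ g : E → ℝ, ContDiffOn ℝ ∞ g V ∧
      ∀ᶠ u in 𝓝 u₀, g (γ u) = u := by
  obtain ⟨ℓ, hℓ⟩ := SeparatingDual.exists_ne_zero (R := ℝ) h
  have hf : ContDiff ℝ ∞ (fun u => ℓ (γ u)) := ℓ.contDiff.comp hγ
  have hder : ∀ u, HasDerivAt (fun u => ℓ (γ u)) (deriv (fun u => ℓ (γ u)) u) u := fun u =>
    (hf.differentiable (by simp) u).hasDerivAt
  have h0 : deriv (fun u => ℓ (γ u)) u₀ ≠ 0 := by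
    have : HasDerivAt (fun u => ℓ (γ u)) (ℓ (deriv γ u₀)) u₀ :=
      ℓ.hasFDerivAt.comp_hasDerivAt u₀ (hγ.differentiable (by simp) u₀).hasDerivAt
    rwa [this.deriv]
  let e := hf.contDiffAt.toOpenPartialHomeomorph _ ((hder u₀).hasFDerivAt_equiv h0) (by simp)
  have hu₀ : u₀ ∈ e.source := hf.contDiffAt.mem_toOpenPartialHomeomorph_source _ _
  have hO : IsOpen {u | deriv (fun u => ℓ (γ u)) u ≠ 0} :=
    isOpen_ne_fun (hf.continuous_deriv (by simp)) continuous_const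
  have hW := e.isOpen_inter_preimage_symm hO
  have hleft : ∀ u ∈ e.source, e.symm (ℓ (γ u)) = u := fun u hu => e.left_inv hu
  have hV : IsOpen (ℓ ⁻¹' (e.target ∩ e.symm ⁻¹' {u | deriv (fun u => ℓ (γ u)) u ≠ 0})) :=
    hW.preimage ℓ.continuous
  refine ⟨_, hV.mem_nhds ⟨e.map_source hu₀, ?_⟩, fun z => e.symm (ℓ z), ?_, ?_⟩
  · change deriv _ (e.symm (ℓ (γ u₀))) ≠ 0
    rwa [hleft u₀ hu₀]
  · intro z hz
    have : ContDiffAt ℝ ∞ e.symm (ℓ z) :=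
      e.contDiffAt_symm_deriv (a := ℓ z) hz.2 hz.1 (hder _) hf.contDiffAt
    exact (this.comp z ℓ.contDiff.contDiffAt).contDiffWithinAt
  · filter_upwards [e.open_source.mem_nhds hu₀] with u hu using hleft u hu

variable [FiniteDimensional ℝ E]

/-- The parameter of a properly embedded ray extends to a smooth function on the whole space. -/
theorem exists_contDiff_leftInverse_of_proper {γ : ℝ → E} (hγ : ContDiff ℝ ∞ γ) {a : ℝ}
    (hinj : InjOn γ (Ici a)) (himm : ∀ t ∈ Ici a, deriv γ t ≠ 0)
    (hprop : ∀ K, IsCompact K → IsCompact {t | a ≤ t ∧ γ t ∈ K}) :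
    ∃ τ : E → ℝ, ContDiff ℝ ∞ τ ∧ ∀ u, a ≤ u → τ (γ u) = u := by
  have : ProperSpace E := FiniteDimensional.proper ℝ E
  obtain ⟨g, hg⟩ := exists_contMDiffMap_forall_mem_convex_of_local (n := ⊤) 𝓘(ℝ, E)
    (t := fun z => {s : ℝ | ∀ u, a ≤ u → γ u = z → s = u}) (fun z => by
      intro x hx y hy p q _ _ hpq u hu huz
      rw [hx u hu huz, hy u hu huz, ← add_smul, hpq, one_smul]) (fun z => by
      by_cases hz : z ∈ γ '' Ici a
      · obtain ⟨u₀, hu₀, rfl⟩ := hz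
        obtain ⟨V, hV, g, hgV, hg⟩ :=
          exists_contDiffOn_leftInverse_of_deriv_ne_zero hγ (himm u₀ hu₀)
        obtain ⟨O, hOg, hO, huO⟩ := _root_.mem_nhds_iff.1 hg
        have hcl : IsClosed (γ '' (Ici a ∩ Oᶜ)) :=
          isClosed_image_of_proper hγ.continuous hprop (isClosed_Ici.inter hO.isClosed_compl)
            inter_subset_left
        have hnot : γ u₀ ∈ (γ '' (Ici a ∩ Oᶜ))ᶜ := by
          rintro ⟨u, ⟨hu, huO'⟩, h⟩
          exact huO' (hinj hu hu₀ h ▸ huO)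
        refine ⟨_, inter_mem hV (hcl.isOpen_compl.mem_nhds hnot), g,
          (hgV.mono inter_subset_left).contMDiffOn, ?_⟩
        rintro y ⟨-, hy⟩ u hu rfl
        by_cases huO' : u ∈ O
        · exact hOg huO'
        · exact absurd ⟨u, ⟨hu, huO'⟩, rfl⟩ hy
      · refine ⟨_, (isClosed_image_of_proper hγ.continuous hprop isClosed_Ici
          subset_rfl).isOpen_compl.mem_nhds hz, fun _ => 0, contMDiffOn_const, ?_⟩
        rintro y hy u hu rfl
        exact absurd ⟨u, hu, rfl⟩ hy)
  exact ⟨g, g.contMDiff.contDiff, fun u hu => hg (γ u) u hu rfl⟩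

/-- A properly embedded ray can be prolonged a little beyond its endpoint, and the parameter of
the prolonged ray is the restriction of a smooth function on the whole space. -/
theorem exists_prolongation_of_proper {γ : ℝ → E} (hγ : ContDiffOn ℝ ∞ γ (Ici 0))
    (hinj : InjOn γ (Ici 0)) (himm : ∀ t ∈ Ici (0 : ℝ), derivWithin γ (Ici 0) t ≠ 0)
    (hprop : ∀ K, IsCompact K → IsCompact {t | 0 ≤ t ∧ γ t ∈ K}) :
    ∃ (Γ : ℝ → E) (τ : E → ℝ), ContDiff ℝ ∞ Γ ∧ ContDiff ℝ ∞ τ ∧ (∀ u, 0 ≤ u → τ (Γ u) = u) ∧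
      Γ '' Ici 1 = γ '' Ici 0 := by
  have : ProperSpace E := FiniteDimensional.proper ℝ E
  have : CompleteSpace E := FiniteDimensional.complete ℝ E
  obtain ⟨β, hβ, hβγ⟩ := hγ.exists_contDiff_eqOn_Ici
  have hβinj : InjOn β (Ici 0) := fun x hx y hy h => hinj hx hy (by rwa [← hβγ hx, ← hβγ hy])
  have hβimm : ∀ t ∈ Ici (0 : ℝ), deriv β t ≠ 0 := fun t ht => by
    rw [← ((hβ.differentiable (by simp)) t).derivWithin (uniqueDiffOn_Ici 0 t ht),
      derivWithin_congr hβγ (hβγ ht)]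
    exact himm t ht
  have hβprop : ∀ K, IsCompact K → IsCompact {t | 0 ≤ t ∧ β t ∈ K} := fun K hK => by
    convert hprop K hK using 1
    ext t
    exact and_congr_right fun ht => by rw [hβγ ht]
  have hev : ∀ᶠ u in 𝓝 (0 : ℝ), deriv β u ≠ 0 :=
    (hβ.continuous_deriv (by simp)).continuousAt.eventually_ne (hβimm 0 self_mem_Ici)
  obtain ⟨-, -, g, -, hg⟩ := exists_contDiffOn_leftInverse_of_deriv_ne_zero hβ (hβimm 0 self_mem_Ici)
  obtain ⟨δ, hδ, hδb⟩ := Metric.eventually_nhds_iff_ball.1 (hev.and hg)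
  have hcl : IsClosed (β '' Ici (δ / 2)) := isClosed_image_of_proper hβ.continuous hβprop
    isClosed_Ici fun t ht => (half_pos hδ).le.trans ht
  have hnot : β 0 ∈ (β '' Ici (δ / 2))ᶜ := by
    rintro ⟨u, hu, h⟩
    have hu' : δ / 2 ≤ u := hu
    have := hβinj (show (0 : ℝ) ≤ u by linarith) (le_refl (0 : ℝ)) h
    linarith
  obtain ⟨ε', hε', hεb⟩ := Metric.eventually_nhds_iff_ball.1
    (hβ.continuous.continuousAt.eventually (hcl.isOpen_compl.mem_nhds hnot))
  obtain ⟨ε, hε, hεδ, hεε⟩ : ∃ ε > 0, ε < δ ∧ ε < ε' :=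
    ⟨min δ ε' / 2, half_pos (lt_min hδ hε'), by linarith [min_le_left δ ε', lt_min hδ hε'],
      by linarith [min_le_right δ ε', lt_min hδ hε']⟩
  have hlt : ∀ s t, -ε ≤ s → s < t → β s ≠ β t := fun s t hs hst h => by
    by_cases ht : t < δ
    · have e1 := (hδb s (by rw [Real.ball_eq_Ioo]; constructor <;> linarith)).2
      have e2 := (hδb t (by rw [Real.ball_eq_Ioo]; constructor <;> linarith)).2
      rw [h, e2] at e1
      linarith
    · by_cases hs0 : 0 ≤ s
      · have := hβinj hs0 (hs0.trans hst.le) h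
        linarith
      · exact hεb s (by rw [Real.ball_eq_Ioo]; constructor <;> linarith)
          ⟨t, by change δ / 2 ≤ t; linarith, h.symm⟩
  obtain ⟨τ, hτ, hτβ⟩ := exists_contDiff_leftInverse_of_proper (a := -ε) hβ
    (fun s hs t ht h => by
      by_contra hne
      rcases lt_or_gt_of_ne hne with h' | h'
      · exact hlt s t hs h' h
      · exact hlt t s ht h' h.symm)
    (fun t ht => by
      by_cases ht0 : 0 ≤ t
      · exact hβimm t ht0
      · have : -ε ≤ t := ht
        exact (hδb t (by rw [Real.ball_eq_Ioo]; constructor <;> linarith)).1)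
    (fun K hK => by
      have h1 : IsCompact (Icc (-ε) 0 ∩ β ⁻¹' K) :=
        isCompact_Icc.inter_right (hK.isClosed.preimage hβ.continuous)
      convert h1.union (hβprop K hK) using 1
      ext t
      simp only [mem_ofPred_eq, mem_union, mem_inter_iff, mem_Icc, mem_preimage]
      constructor
      · rintro ⟨h, hK⟩
        rcases le_total t 0 with h0 | h0
        · exact Or.inl ⟨⟨h, h0⟩, hK⟩
        · exact Or.inr ⟨h0, hK⟩
      · rintro (⟨⟨h, -⟩, hK⟩ | ⟨h, hK⟩)
        · exact ⟨h, hK⟩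
        · exact ⟨by linarith, hK⟩)
  refine ⟨fun u => β (ε * (u - 1)), fun z => τ z / ε + 1, ?_, ?_, fun u hu => ?_, ?_⟩
  · exact hβ.comp (contDiff_const.mul (contDiff_id.sub contDiff_const))
  · exact (hτ.div_const _).add contDiff_const
  · change τ (β (ε * (u - 1))) / ε + 1 = u
    rw [hτβ _ (by nlinarith)]
    field_simp
    ring
  · ext z
    constructor
    · rintro ⟨u, hu, rfl⟩
      have : (0 : ℝ) ≤ ε * (u - 1) := mul_nonneg hε.le (sub_nonneg.2 hu)
      exact ⟨_, this, (hβγ this).symm⟩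
    · rintro ⟨t, ht, rfl⟩
      refine ⟨t / ε + 1, ?_, ?_⟩
      · have : 0 ≤ t / ε := div_nonneg ht hε.le
        change 1 ≤ t / ε + 1
        linarith
      · change β (ε * (t / ε + 1 - 1)) = γ t
        rw [add_sub_cancel_right, mul_div_cancel₀ _ hε.ne', hβγ ht]

end EmbeddedRay

section Trapping

open Filter Topology Bornology
open scoped ContDiff

variable {E : Type*} [NormedAddCommGroup E] [NormedSpace ℝ E] {X Y : E → E} {F G τ κ : E → ℝ}
  {c : ℝ → E} {T : ℝ}

theorem SolvesOn.hasDerivAt_comp (h : SolvesOn X T c) (hF : ContDiff ℝ ∞ F) :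
    ∀ t ∈ Icc 0 T, HasDerivAt (fun t => F (c t)) (fderiv ℝ F (c t) (X (c t))) t := fun t ht =>
  HasFDerivAt.comp_hasDerivAt (l := F) (f := c) t
    (hF.differentiable (by simp) (c t)).hasFDerivAt (h t ht)

theorem SolvesOn.le_comp (h : SolvesOn X T c) (hF : ContDiff ℝ ∞ F)
    (hmono : ∀ t ∈ Icc 0 T, 0 ≤ fderiv ℝ F (c t) (X (c t))) {t : ℝ} (ht : t ∈ Icc 0 T) :
    F (c 0) ≤ F (c t) := by
  have hd := h.hasDerivAt_comp hF
  refine monotoneOn_of_deriv_nonneg (convex_Icc 0 T)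
    (fun t ht => (hd t ht).continuousAt.continuousWithinAt)
    (fun t ht => (hd t (interior_subset ht)).differentiableAt.differentiableWithinAt)
    (fun t ht => ?_) ⟨le_rfl, ht.1.trans ht.2⟩ ht ht.1
  rw [(hd t (interior_subset ht)).deriv]
  exact hmono t (interior_subset ht)

theorem SolvesOn.comp_eq (h : SolvesOn X T c) (hF : ContDiff ℝ ∞ F)
    (hconst : ∀ z, fderiv ℝ F z (X z) = 0) {t : ℝ} (ht : t ∈ Icc 0 T) : F (c t) = F (c 0) :=
  constant_of_has_deriv_right_zero (f := fun t => F (c t))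
    (fun t ht => (h.hasDerivAt_comp hF t ht).continuousAt.continuousWithinAt)
    (fun t ht => (hconst (c t) ▸ h.hasDerivAt_comp hF t (Ico_subset_Icc_self ht)).hasDerivWithinAt)
    t ht

/-- An integral curve that reaches a zero of the vector field is constant. -/
theorem SolvesOn.eq_of_eq_zero (hX : ContDiff ℝ ∞ X) (h : SolvesOn X T c) {s : ℝ}
    (hs : s ∈ Icc 0 T) (h0 : X (c s) = 0) : c 0 = c s := by
  have h1 : SolvesOn (fun z => -X z) s (fun _ => c s) := fun t _ => by
    simpa [h0] using hasDerivAt_const t (c s)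
  simpa using (h.mono hs.2).reverse.eqOn hX.neg h1 (by simp) ⟨hs.1, le_rfl⟩

theorem SolvesOn.pos_of_pos (hX : ContDiff ℝ ∞ X) (hF : ContDiff ℝ ∞ F)
    (hXF : ∀ z, fderiv ℝ F z (X z) = 0) (hXG : ∀ z, F z = 0 → G z = 0 → X z = 0)
    (hG : ∀ z, 0 ≤ G z) (h : SolvesOn X T c) (hF0 : F (c 0) = 0) (hG0 : 0 < G (c 0)) {t : ℝ}
    (ht : t ∈ Icc 0 T) : F (c t) = 0 ∧ 0 < G (c t) := by
  have h1 := (h.comp_eq hF hXF ht).trans hF0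
  refine ⟨h1, (hG _).lt_of_ne fun h0 => ?_⟩
  rw [h.eq_of_eq_zero hX ht (hXG _ h1 h0.symm), ← h0] at hG0
  exact lt_irrefl _ hG0

theorem exists_solvesOn_of_eq_zero {z : E} (hz : X z = 0) : ∃ c, c 0 = z ∧ SolvesOn X 1 c :=
  ⟨fun _ => z, rfl, fun t _ => by simpa [hz] using hasDerivAt_const t z⟩

variable [FiniteDimensional ℝ E]

theorem exists_solvesOn_of_isBounded (hX : ContDiff ℝ ∞ X) {K : Set E} (hK : IsBounded K) {z : E}
    (h : ∀ S ∈ Icc (0 : ℝ) 1, ∀ c, c 0 = z → SolvesOn X S c → c S ∈ K) :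
    ∃ c, c 0 = z ∧ SolvesOn X 1 c := by
  obtain ⟨R, hR⟩ := hK.exists_norm_le
  exact exists_solvesOn_of_bound hX zero_le_one fun S hS c hc0 hc => hR _ (h S hS c hc0 hc)

theorem exists_solvesOn_of_ne_zero (hX : ContDiff ℝ ∞ X) (hF : ContDiff ℝ ∞ F)
    (hXF : ∀ z, fderiv ℝ F z (X z) = 0) (hFb : ∀ ε > 0, IsBounded {z | ε ≤ |F z|}) {z : E}
    (hz : F z ≠ 0) : ∃ c, c 0 = z ∧ SolvesOn X 1 c :=
  exists_solvesOn_of_isBounded hX (hFb |F z| (abs_pos.2 hz)) fun S hS c hc0 hc => by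
    change |F z| ≤ |F (c S)|
    rw [hc.comp_eq hF hXF ⟨hS.1, le_rfl⟩, hc0]

/-- Backward trajectories are defined for time one. -/
theorem exists_solvesOn_backward (hX : ContDiff ℝ ∞ X) (hF : ContDiff ℝ ∞ F)
    (hXF : ∀ z, fderiv ℝ F z (X z) = 0) (hFb : ∀ ε > 0, IsBounded {z | ε ≤ |F z|})
    (hG : ∀ z, 0 ≤ G z) (hXG : ∀ z, F z = 0 → X z = G z • Y z) (hτ : ContDiff ℝ ∞ τ)
    (hτY : ∀ z, 0 < G z → 0 ≤ fderiv ℝ τ z (Y z))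
    (hτb : ∀ T, IsBounded {z | 0 < G z ∧ τ z ≤ T}) (z : E) :
    ∃ c, c 0 = z ∧ SolvesOn (fun z => -X z) 1 c := by
  have hXF' : ∀ z, fderiv ℝ F z (-X z) = 0 := fun z => by rw [map_neg, hXF, neg_zero]
  by_cases hz : F z = 0
  · rcases (hG z).eq_or_lt with hGz | hGz
    · exact exists_solvesOn_of_eq_zero (by rw [hXG z hz, ← hGz, zero_smul, neg_zero])
    · refine exists_solvesOn_of_isBounded hX.neg (hτb (τ z)) fun S hS c hc0 hc => ?_
      have hpos := fun t ht => hc.pos_of_pos (t := t) (G := G) hX.neg hF hXF'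
        (fun z h1 h2 => by rw [hXG z h1, h2, zero_smul, neg_zero]) hG (hc0 ▸ hz) (hc0 ▸ hGz) ht
      refine ⟨(hpos S ⟨hS.1, le_rfl⟩).2, ?_⟩
      have := hc.le_comp (F := fun z => -τ z) hτ.neg (fun t ht => ?_) ⟨hS.1, le_rfl⟩
      · rw [hc0] at this
        linarith
      · have h1 := hpos t ht
        rw [fderiv_fun_neg, hXG _ h1.1, neg_apply, map_neg, neg_neg, map_smul, smul_eq_mul]
        exact mul_nonneg h1.2.le (hτY _ h1.2)
  · exact exists_solvesOn_of_ne_zero hX.neg hF hXF' hFb hz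

/-- Trajectories on which `κ` does not vanish are defined for time one. -/
theorem exists_solvesOn_forward (hX : ContDiff ℝ ∞ X) (hF : ContDiff ℝ ∞ F)
    (hXF : ∀ z, fderiv ℝ F z (X z) = 0) (hFb : ∀ ε > 0, IsBounded {z | ε ≤ |F z|})
    (hG : ∀ z, 0 ≤ G z) (hXG : ∀ z, F z = 0 → X z = G z • Y z)
    (hτb : ∀ T, IsBounded {z | 0 < G z ∧ τ z ≤ T}) (hκ : ContDiff ℝ ∞ κ)
    (hκY : ∀ z, 0 < G z → 0 ≤ fderiv ℝ κ z (Y z))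
    (hκτ : ∀ z, 0 < G z → κ z ≤ Real.exp (-τ z)) {z : E}
    (hκz : F z = 0 → 0 < G z → 0 < κ z) : ∃ c, c 0 = z ∧ SolvesOn X 1 c := by
  by_cases hz : F z = 0
  · rcases (hG z).eq_or_lt with hGz | hGz
    · exact exists_solvesOn_of_eq_zero (by rw [hXG z hz, ← hGz, zero_smul])
    · have hκ0 := hκz hz hGz
      refine exists_solvesOn_of_isBounded hX (hτb (-Real.log (κ z))) fun S hS c hc0 hc => ?_
      have hpos := fun t ht => hc.pos_of_pos (t := t) (G := G) hX hF hXF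
        (fun z h1 h2 => by rw [hXG z h1, h2, zero_smul]) hG (hc0 ▸ hz) (hc0 ▸ hGz) ht
      have hS' := (hpos S ⟨hS.1, le_rfl⟩).2
      refine ⟨hS', ?_⟩
      have := hc.le_comp hκ (fun t ht => ?_) ⟨hS.1, le_rfl⟩
      · rw [hc0] at this
        have := (Real.log_le_iff_le_exp hκ0).2 (this.trans (hκτ _ hS'))
        linarith
      · have h1 := hpos t ht
        rw [hXG _ h1.1, map_smul, smul_eq_mul]
        exact mul_nonneg h1.2.le (hκY _ h1.2)
  · exact exists_solvesOn_of_ne_zero hX hF hXF hFb hz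

end Trapping

section RayDynamics

open Filter Topology
open scoped ContDiff

variable {E : Type*} [NormedAddCommGroup E] [NormedSpace ℝ E] {X : E → E} {Γ : ℝ → E} {τ : E → ℝ}

/-- The speed on the ray. Its flow is conjugate, via `u ↦ exp (1 / u)`, to a translation that moves
exactly the points `u ≥ 1` to infinity within time one. -/
def raySpeed (u : ℝ) : ℝ := (Real.exp 1 - 1) * u ^ 2 * expNegInvGlue u

theorem contDiff_raySpeed : ContDiff ℝ ∞ raySpeed :=
  (contDiff_const.mul (contDiff_id.pow 2)).mul expNegInvGlue.contDiff

theorem exp_one_sub_one_pos : 0 < Real.exp 1 - 1 := by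
  have := Real.add_one_lt_exp (one_ne_zero (α := ℝ))
  linarith

theorem raySpeed_nonneg (u : ℝ) : 0 ≤ raySpeed u :=
  mul_nonneg (mul_nonneg exp_one_sub_one_pos.le (sq_nonneg u)) (expNegInvGlue.nonneg u)

theorem raySpeed_of_nonpos {u : ℝ} (hu : u ≤ 0) : raySpeed u = 0 := by
  rw [raySpeed, expNegInvGlue.zero_of_nonpos hu, mul_zero]

/-- The trajectory of the vector field `raySpeed` on the line starting at `u₀`. -/
def rayFlow (u₀ t : ℝ) : ℝ := (Real.log (Real.exp u₀⁻¹ - (Real.exp 1 - 1) * t))⁻¹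

theorem rayFlow_zero (u₀ : ℝ) : rayFlow u₀ 0 = u₀ := by simp [rayFlow]

theorem rayFlow_pos {u₀ t : ℝ} (h : 1 < Real.exp u₀⁻¹ - (Real.exp 1 - 1) * t) :
    0 < rayFlow u₀ t := inv_pos.2 (Real.log_pos h)

theorem le_rayFlow {u₀ t : ℝ} (hu₀ : 0 < u₀) (ht : 0 ≤ t)
    (h : 1 < Real.exp u₀⁻¹ - (Real.exp 1 - 1) * t) : u₀ ≤ rayFlow u₀ t := by
  rw [rayFlow, le_inv_comm₀ hu₀ (Real.log_pos h), Real.log_le_iff_le_exp (by linarith)]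
  linarith [mul_nonneg exp_one_sub_one_pos.le ht]

theorem hasDerivAt_rayFlow {u₀ t : ℝ} (h : 1 < Real.exp u₀⁻¹ - (Real.exp 1 - 1) * t) :
    HasDerivAt (rayFlow u₀) (raySpeed (rayFlow u₀ t)) t := by
  have hw : HasDerivAt (fun t => Real.exp u₀⁻¹ - (Real.exp 1 - 1) * t) (-(Real.exp 1 - 1)) t := by
    simpa using ((hasDerivAt_id t).const_mul (Real.exp 1 - 1)).const_sub (Real.exp u₀⁻¹)
  have hlog := Real.log_pos h
  refine ((hw.log (by linarith)).inv hlog.ne').congr_deriv ?_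
  rw [raySpeed, expNegInvGlue, if_neg (not_le.2 (rayFlow_pos h)), rayFlow, inv_inv, Real.exp_neg,
    Real.exp_log (by linarith)]
  field_simp

theorem solvesOn_ray (hΓ : ContDiff ℝ ∞ Γ)
    (hXΓ : ∀ u, 0 < u → X (Γ u) = raySpeed u • deriv Γ u) {u₀ T : ℝ}
    (hT : 1 < Real.exp u₀⁻¹ - (Real.exp 1 - 1) * T) : SolvesOn X T (fun t => Γ (rayFlow u₀ t)) := by
  intro t ht
  have ht' : 1 < Real.exp u₀⁻¹ - (Real.exp 1 - 1) * t :=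
    hT.trans_le (by nlinarith [ht.2, exp_one_sub_one_pos])
  rw [hXΓ _ (rayFlow_pos ht')]
  exact (hΓ.differentiable (by simp) _).hasDerivAt.scomp t (hasDerivAt_rayFlow ht')

theorem exists_solvesOn_ray (hΓ : ContDiff ℝ ∞ Γ)
    (hXΓ : ∀ u, 0 < u → X (Γ u) = raySpeed u • deriv Γ u) {u₀ : ℝ} (h0 : 0 < u₀) (h1 : u₀ < 1) :
    ∃ c, c 0 = Γ u₀ ∧ SolvesOn X 1 c := by
  refine ⟨fun t => Γ (rayFlow u₀ t), by simp [rayFlow_zero], solvesOn_ray hΓ hXΓ ?_⟩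
  have : Real.exp 1 < Real.exp u₀⁻¹ := Real.exp_lt_exp.2 ((one_lt_inv₀ h0).2 h1)
  linarith

/-- Trajectories starting on the part `u ≥ 1` of the ray leave every compact set before time one. -/
theorem SolvesOn.lt_one_of_ray (hX : ContDiff ℝ ∞ X) (hΓ : ContDiff ℝ ∞ Γ) (hτ : Continuous τ)
    (hτΓ : ∀ u, 0 ≤ u → τ (Γ u) = u) (hXΓ : ∀ u, 0 < u → X (Γ u) = raySpeed u • deriv Γ u)
    {u₀ T : ℝ} (h1 : 1 ≤ u₀) {c : ℝ → E} (hc0 : c 0 = Γ u₀) (hc : SolvesOn X T c) :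
    T < 1 ∧ ∀ t ∈ Icc 0 T, c t ∈ Γ '' Ici 1 := by
  have he := exp_one_sub_one_pos
  have hu₀ : 0 < u₀ := by linarith
  set s : ℝ := (Real.exp u₀⁻¹ - 1) / (Real.exp 1 - 1) with hs
  have hse : (Real.exp 1 - 1) * s = Real.exp u₀⁻¹ - 1 := by rw [hs]; field_simp
  have hs0 : 0 < s := div_pos (by have := Real.one_lt_exp_iff.2 (inv_pos.2 hu₀); linarith) he
  have hs1 : s ≤ 1 := by
    rw [hs, div_le_one he]
    have := Real.exp_le_exp.2 (inv_le_one_of_one_le₀ h1)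
    linarith
  have hw : ∀ t, t < s → 1 < Real.exp u₀⁻¹ - (Real.exp 1 - 1) * t := fun t ht => by nlinarith
  have heq : ∀ t ∈ Icc 0 T, t < s → c t = Γ (rayFlow u₀ t) := fun t ht hts =>
    (hc.mono ht.2).eqOn hX (solvesOn_ray hΓ hXΓ (hw t hts)) (by rw [hc0, rayFlow_zero])
      ⟨ht.1, le_rfl⟩
  have hTs : T < s := by
    by_contra! hsT
    obtain ⟨M, hM⟩ := isCompact_Icc.exists_bound_of_continuousOn
      (hτ.comp_continuousOn hc.continuousOn)
    have hlim : Tendsto (fun t => (Real.exp 1 - 1) * (s - t)) (𝓝[<] s) (𝓝[>] 0) := by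
      refine tendsto_nhdsWithin_iff.2 ⟨?_, ?_⟩
      · have : Tendsto (fun t => (Real.exp 1 - 1) * (s - t)) (𝓝 s)
            (𝓝 ((Real.exp 1 - 1) * (s - s))) := Continuous.tendsto (by fun_prop) s
        rw [sub_self, mul_zero] at this
        exact this.mono_left nhdsWithin_le_nhds
      · filter_upwards [self_mem_nhdsWithin] with t ht
        exact mul_pos he (sub_pos.2 ht)
    have h2 := (tendsto_inv_nhdsGT_zero.comp hlim).eventually_gt_atTop M
    obtain ⟨t, htM, ht0, hts⟩ := (h2.and (Ioo_mem_nhdsLT hs0)).exists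
    have htT : t ∈ Icc 0 T := ⟨ht0.le, hts.le.trans hsT⟩
    have h3 := hM t htT
    have hwt := hw t hts
    rw [Function.comp_apply, heq t htT hts, hτΓ _ (rayFlow_pos hwt).le, Real.norm_eq_abs] at h3
    have h4 : (((Real.exp 1 - 1) * (s - t))⁻¹ : ℝ) ≤ rayFlow u₀ t := by
      rw [rayFlow]
      refine inv_anti₀ (Real.log_pos hwt) ?_
      have := Real.log_le_sub_one_of_pos (show 0 < Real.exp u₀⁻¹ - (Real.exp 1 - 1) * t by linarith)
      linarith
    have h5 : M < ((Real.exp 1 - 1) * (s - t))⁻¹ := htM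
    linarith [le_abs_self (rayFlow u₀ t)]
  refine ⟨hTs.trans_le hs1, fun t ht => ?_⟩
  have hts := ht.2.trans_lt hTs
  exact ⟨_, h1.trans (le_rayFlow hu₀ ht.1 (hw t hts)), (heq t ht hts).symm⟩

end RayDynamics

section HamiltonianVectorField

open scoped ContDiff

variable {E : Type*} [NormedAddCommGroup E] [NormedSpace ℝ E] [FiniteDimensional ℝ E]

/-- Every smooth function has a smooth Hamiltonian vector field. -/
theorem exists_hamiltonian_vectorField {Ω : E → E →L[ℝ] E →L[ℝ] ℝ} (hΩ : ContDiff ℝ ∞ Ω)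
    (hnondeg : ∀ z u, (∀ v, Ω z u v = 0) → u = 0) {F : E → ℝ} (hF : ContDiff ℝ ∞ F) :
    ∃ X : E → E, ContDiff ℝ ∞ X ∧ ∀ z w, Ω z (X z) w = fderiv ℝ F z w := by
  have hrank : Module.finrank ℝ E = Module.finrank ℝ (E →L[ℝ] ℝ) := by
    rw [← (LinearMap.toContinuousLinearMap (𝕜 := ℝ) (E := E) (F' := ℝ)).finrank_eq]
    exact Subspace.dual_finrank_eq.symm
  have hinj : ∀ z, Function.Injective (Ω z).toLinearMap := fun z =>
    (injective_iff_map_eq_zero _).2 fun u hu => hnondeg z u fun v => congrArg (fun L => L v) hu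
  have hequiv : ∀ z, ∃ e : E ≃L[ℝ] (E →L[ℝ] ℝ), (e : E →L[ℝ] E →L[ℝ] ℝ) = Ω z := fun z =>
    ⟨(LinearEquiv.ofInjectiveOfFinrankEq _ (hinj z) hrank).toContinuousLinearEquiv, by
      ext u v; rfl⟩
  have : CompleteSpace E := FiniteDimensional.complete ℝ E
  refine ⟨fun z => (Ω z).inverse (fderiv ℝ F z), ?_, fun z w => ?_⟩
  · refine contDiff_iff_contDiffAt.2 fun z => ?_
    obtain ⟨e, he⟩ := hequiv z
    have h1 : ContDiffAt ℝ ∞ ContinuousLinearMap.inverse (Ω z) := he ▸ contDiffAt_map_inverse e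
    exact (h1.comp z hΩ.contDiffAt).clm_apply (hF.fderiv_right (by simp)).contDiffAt
  · obtain ⟨e, he⟩ := hequiv z
    change Ω z ((Ω z).inverse (fderiv ℝ F z)) w = _
    rw [← he, ContinuousLinearMap.inverse_equiv]
    simp

end HamiltonianVectorField

section RayFunctions

open Filter Topology
open scoped ContDiff Manifold

variable {E : Type*} [NormedAddCommGroup E]

/-- The displacement of a point from the point of the ray with the same parameter. -/
def rayOffset (Γ : ℝ → E) (τ : E → ℝ) (z : E) : E := z - Γ (τ z)

theorem rayOffset_ray {Γ : ℝ → E} {τ : E → ℝ} (hτΓ : ∀ u, 0 ≤ u → τ (Γ u) = u) {u : ℝ}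
    (hu : 0 ≤ u) :
    rayOffset Γ τ (Γ u) = 0 := by rw [rayOffset, hτΓ u hu, sub_self]

variable [NormedSpace ℝ E]

/-- The square length of the displacement with respect to the form `B`. -/
def raySq (B : E →L[ℝ] E →L[ℝ] ℝ) (Γ : ℝ → E) (τ : E → ℝ) (z : E) : ℝ :=
  B (rayOffset Γ τ z) (rayOffset Γ τ z)

/-- A function vanishing on the ray whose Hamiltonian vector field is tangent to the ray. -/
def rayHeight (Ω : E → E →L[ℝ] E →L[ℝ] ℝ) (Γ : ℝ → E) (τ : E → ℝ) (z : E) : ℝ :=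
  Ω (Γ (τ z)) (deriv Γ (τ z)) (rayOffset Γ τ z)

variable {B : E →L[ℝ] E →L[ℝ] ℝ} {Ω : E → E →L[ℝ] E →L[ℝ] ℝ} {Γ : ℝ → E} {τ : E → ℝ}

theorem contDiff_rayOffset (hΓ : ContDiff ℝ ∞ Γ) (hτ : ContDiff ℝ ∞ τ) :
    ContDiff ℝ ∞ (rayOffset Γ τ) := contDiff_id.sub (hΓ.comp hτ)

theorem contDiff_raySq (hΓ : ContDiff ℝ ∞ Γ) (hτ : ContDiff ℝ ∞ τ) :
    ContDiff ℝ ∞ (raySq B Γ τ) :=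
  (contDiff_const.clm_apply (contDiff_rayOffset hΓ hτ)).clm_apply (contDiff_rayOffset hΓ hτ)

theorem contDiff_rayHeight (hΩ : ContDiff ℝ ∞ Ω) (hΓ : ContDiff ℝ ∞ Γ) (hτ : ContDiff ℝ ∞ τ) :
    ContDiff ℝ ∞ (rayHeight Ω Γ τ) :=
  ((hΩ.comp (hΓ.comp hτ)).clm_apply ((contDiff_infty_iff_deriv.1 hΓ).2.comp hτ)).clm_apply
    (contDiff_rayOffset hΓ hτ)

theorem fderiv_rayOffset_apply (hΓ : ContDiff ℝ ∞ Γ) (hτ : ContDiff ℝ ∞ τ) (z w : E) :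
    fderiv ℝ (rayOffset Γ τ) z w = w - fderiv ℝ τ z w • deriv Γ (τ z) := by
  have h1 : HasFDerivAt (fun z => Γ (τ z)) _ z :=
    (hΓ.differentiable (by simp) (τ z)).hasDerivAt.hasFDerivAt.comp z
      (hτ.differentiable (by simp) z).hasFDerivAt
  have h2 : HasFDerivAt (rayOffset Γ τ) _ z := (hasFDerivAt_id z).sub h1
  rw [h2.fderiv]
  simp

theorem fderiv_raySq_apply (hΓ : ContDiff ℝ ∞ Γ) (hτ : ContDiff ℝ ∞ τ) (z w : E) :
    fderiv ℝ (raySq B Γ τ) z w = B (rayOffset Γ τ z) (fderiv ℝ (rayOffset Γ τ) z w) +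
      B (fderiv ℝ (rayOffset Γ τ) z w) (rayOffset Γ τ z) := by
  have h1 := ((contDiff_rayOffset hΓ hτ).differentiable (by simp) z).hasFDerivAt
  have h2 : HasFDerivAt (raySq B Γ τ) _ z := B.hasFDerivAt_of_bilinear h1 h1
  rw [h2.fderiv]
  simp

theorem rayHeight_ray (hτΓ : ∀ u, 0 ≤ u → τ (Γ u) = u) {u : ℝ} (hu : 0 ≤ u) :
    rayHeight Ω Γ τ (Γ u) = 0 := by rw [rayHeight, rayOffset_ray hτΓ hu, map_zero]

theorem fderiv_parameter_ray (hΓ : ContDiff ℝ ∞ Γ) (hτ : ContDiff ℝ ∞ τ)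
    (hτΓ : ∀ u, 0 ≤ u → τ (Γ u) = u) {u : ℝ} (hu : 0 ≤ u) :
    fderiv ℝ τ (Γ u) (deriv Γ u) = 1 := by
  have h1 : HasDerivAt (fun u => τ (Γ u)) (fderiv ℝ τ (Γ u) (deriv Γ u)) u :=
    HasFDerivAt.comp_hasDerivAt (l := τ) (f := Γ) u
      (hτ.differentiable (by simp) _).hasFDerivAt (hΓ.differentiable (by simp) u).hasDerivAt
  have h2 : HasDerivWithinAt (fun u => τ (Γ u)) 1 (Ici 0) u :=
    (hasDerivWithinAt_id u _).congr (fun v hv => hτΓ v hv) (hτΓ u hu)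
  exact (uniqueDiffOn_Ici 0 u hu).eq_deriv _ h1.hasDerivWithinAt h2

theorem fderiv_rayHeight_ray (hΩ : ContDiff ℝ ∞ Ω) (halt : ∀ z u v, Ω z u v = -Ω z v u)
    (hΓ : ContDiff ℝ ∞ Γ) (hτ : ContDiff ℝ ∞ τ) (hτΓ : ∀ u, 0 ≤ u → τ (Γ u) = u) {u : ℝ}
    (hu : 0 ≤ u) (w : E) :
    fderiv ℝ (rayHeight Ω Γ τ) (Γ u) w = Ω (Γ u) (deriv Γ u) w := by
  have hK : ContDiff ℝ ∞ (fun z => Ω (Γ (τ z)) (deriv Γ (τ z))) :=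
    (hΩ.comp (hΓ.comp hτ)).clm_apply ((contDiff_infty_iff_deriv.1 hΓ).2.comp hτ)
  have h1 : HasFDerivAt (rayHeight Ω Γ τ) _ (Γ u) :=
    (hK.differentiable (by simp) (Γ u)).hasFDerivAt.clm_apply
      ((contDiff_rayOffset hΓ hτ).differentiable (by simp) (Γ u)).hasFDerivAt
  have h2 : Ω (Γ u) (deriv Γ u) (deriv Γ u) = 0 := by
    linarith [halt (Γ u) (deriv Γ u) (deriv Γ u)]
  rw [h1.fderiv]
  simp [rayOffset_ray hτΓ hu, fderiv_rayOffset_apply hΓ hτ, hτΓ u hu, h2]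

theorem sq_norm_rayOffset_le (hB : ∀ x, ‖x‖ ^ 2 ≤ B x x) (z : E) :
    ‖rayOffset Γ τ z‖ ^ 2 ≤ raySq B Γ τ z := hB _

/-- Quantitative control of the tangent field `Y` in a tube around the ray. -/
theorem exists_tube_control (hB : ∀ x, ‖x‖ ^ 2 ≤ B x x) (hΩ : ContDiff ℝ ∞ Ω)
    (hΓ : ContDiff ℝ ∞ Γ) (hτ : ContDiff ℝ ∞ τ) (hτΓ : ∀ u, 0 ≤ u → τ (Γ u) = u) {Y : E → E}
    (hY : ContDiff ℝ ∞ Y) (hYΓ : ∀ u, 0 ≤ u → Y (Γ u) = deriv Γ u) :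
    ∃ A : ℝ → ℝ, ContDiff ℝ ∞ A ∧ (∀ u, 1 ≤ A u) ∧
      ∀ z, 0 ≤ τ z → A (τ z) * raySq B Γ τ z < 1 → 1 / 2 ≤ fderiv ℝ τ z (Y z) ∧
        |fderiv ℝ (raySq B Γ τ) z (Y z)| ≤ A (τ z) * raySq B Γ τ z ∧
        |rayHeight Ω Γ τ z| ≤ A (τ z) * ‖rayOffset Γ τ z‖ := by
  have hr : ∀ z, 0 ≤ raySq B Γ τ z := fun z => (sq_nonneg _).trans (hB _)
  set t : ℝ → Set ℝ := fun u => {N | ∀ z, τ z = u → 0 ≤ u → N * raySq B Γ τ z < 1 →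
    1 / 2 ≤ fderiv ℝ τ z (Y z) ∧ |fderiv ℝ (raySq B Γ τ) z (Y z)| ≤ N * raySq B Γ τ z ∧
    |rayHeight Ω Γ τ z| ≤ N * ‖rayOffset Γ τ z‖} with ht
  have hup : ∀ u, IsUpperSet (t u) := fun u N N' hNN' hN z hz hu h => by
    have h1 : N * raySq B Γ τ z ≤ N' * raySq B Γ τ z := by gcongr; exact hr z
    obtain ⟨h2, h3, h4⟩ := hN z hz hu (h1.trans_lt h)
    exact ⟨h2, h3.trans h1, h4.trans (by gcongr)⟩
  obtain ⟨N, hN⟩ := exists_contMDiffMap_forall_mem_convex_of_local_const (n := ⊤) 𝓘(ℝ, ℝ)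
    (fun u => (hup u).ordConnected.convex) (fun u₀ => by
      rcases lt_or_ge u₀ 0 with hu₀ | hu₀
      · refine ⟨0, ?_⟩
        filter_upwards [eventually_lt_nhds hu₀] with u hu z _ hu'
        exact absurd hu' (not_le.2 hu)
      · set h : E → E := fun z => fderiv ℝ (rayOffset Γ τ) z (Y z) with hh
        have hhs : ContDiff ℝ ∞ h :=
          ((contDiff_rayOffset hΓ hτ).fderiv_right (by simp)).clm_apply hY
        have hh0 : ∀ u, 0 ≤ u → h (Γ u) = 0 := fun u hu => by
          simp only [hh]
          rw [fderiv_rayOffset_apply hΓ hτ, hYΓ u hu, fderiv_parameter_ray hΓ hτ hτΓ hu, hτΓ u hu,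
            one_smul, sub_self]
        obtain ⟨L, V, hV, hL⟩ :=
          ((contDiff_infty.1 hhs 1).contDiffAt (x := Γ u₀)).exists_lipschitzOnWith
        have hdτ : Continuous fun z => fderiv ℝ τ z (Y z) :=
          (hτ.continuous_fderiv (by simp)).clm_apply hY.continuous
        have hhalf : ∀ᶠ z in 𝓝 (Γ u₀), 1 / 2 < fderiv ℝ τ z (Y z) := by
          refine hdτ.continuousAt.eventually_const_lt ?_
          change 1 / 2 < fderiv ℝ τ (Γ u₀) (Y (Γ u₀))
          rw [hYΓ u₀ hu₀, fderiv_parameter_ray hΓ hτ hτΓ hu₀]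
          norm_num
        obtain ⟨δ, hδ, hδV⟩ := Metric.mem_nhds_iff.1 (inter_mem hV hhalf)
        have hcK : Continuous fun u => ‖Ω (Γ u) (deriv Γ u)‖ :=
          ((hΩ.continuous.comp hΓ.continuous).clm_apply (hΓ.continuous_deriv (by simp))).norm
        refine ⟨max (4 / δ ^ 2) (max (2 * ‖B‖ * L) (‖Ω (Γ u₀) (deriv Γ u₀)‖ + 1)), ?_⟩
        filter_upwards [hΓ.continuous.continuousAt.eventually (Metric.ball_mem_nhds _ (half_pos hδ)),
          hcK.continuousAt.eventually_lt_const (lt_add_one _)] with u huδ huK z hz hu hN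
        set N := max (4 / δ ^ 2) (max (2 * ‖B‖ * L) (‖Ω (Γ u₀) (deriv Γ u₀)‖ + 1)) with hNdef
        have hρ : rayOffset Γ τ z = z - Γ u := by rw [rayOffset, hz]
        have h1 : 4 / δ ^ 2 * ‖rayOffset Γ τ z‖ ^ 2 < 1 := lt_of_le_of_lt (by
          gcongr
          · exact le_max_left _ _
          · exact sq_norm_rayOffset_le hB z) hN
        have h2 : ‖z - Γ u‖ < δ / 2 := by
          rw [hρ, div_mul_eq_mul_div, div_lt_one (by positivity)] at h1
          refine lt_of_pow_lt_pow_left₀ 2 (by positivity) ?_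
          linarith [div_pow δ 2 2]
        have hzV : z ∈ V ∩ {z | 1 / 2 < fderiv ℝ τ z (Y z)} := hδV (by
          rw [Metric.mem_ball]
          have := Metric.mem_ball.1 huδ
          refine (dist_triangle z (Γ u) (Γ u₀)).trans_lt ?_
          rw [dist_eq_norm]
          linarith)
        have huV : Γ u ∈ V := (hδV (Metric.ball_subset_ball (by linarith) huδ)).1
        have h3 : ‖h z‖ ≤ L * ‖rayOffset Γ τ z‖ := by
          have := hL.norm_sub_le hzV.1 huV
          rwa [hh0 u hu, sub_zero, ← hρ] at this
        refine ⟨hzV.2.le, ?_, ?_⟩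
        · rw [fderiv_raySq_apply hΓ hτ]
          have e1 := B.le_opNorm₂ (rayOffset Γ τ z) (h z)
          have e2 := B.le_opNorm₂ (h z) (rayOffset Γ τ z)
          have e3 : ‖B‖ * ‖rayOffset Γ τ z‖ * ‖h z‖ ≤
              ‖B‖ * ‖rayOffset Γ τ z‖ * (L * ‖rayOffset Γ τ z‖) := by gcongr
          calc _ ≤ |B (rayOffset Γ τ z) (h z)| + |B (h z) (rayOffset Γ τ z)| := abs_add_le _ _
            _ ≤ ‖B‖ * ‖rayOffset Γ τ z‖ * ‖h z‖ + ‖B‖ * ‖h z‖ * ‖rayOffset Γ τ z‖ :=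
              add_le_add e1 e2
            _ = 2 * (‖B‖ * ‖rayOffset Γ τ z‖ * ‖h z‖) := by ring
            _ ≤ 2 * (‖B‖ * ‖rayOffset Γ τ z‖ * (L * ‖rayOffset Γ τ z‖)) := by linarith
            _ = 2 * ‖B‖ * L * ‖rayOffset Γ τ z‖ ^ 2 := by ring
            _ ≤ N * raySq B Γ τ z := by
              gcongr
              · exact (le_max_left _ _).trans (le_max_right _ _)
              · exact sq_norm_rayOffset_le hB z
        · rw [rayHeight, hz, ← Real.norm_eq_abs]
          refine (ContinuousLinearMap.le_opNorm _ _).trans ?_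
          gcongr
          exact huK.le.trans ((le_max_right _ _).trans (le_max_right _ _)))
  have hNs : ContDiff ℝ ∞ N := N.contMDiff.contDiff
  refine ⟨fun u => 1 + N u ^ 2, contDiff_const.add (hNs.pow 2),
    fun u => le_add_of_nonneg_right (sq_nonneg _), fun z hz h => ?_⟩
  exact hup _ (show N (τ z) ≤ 1 + N (τ z) ^ 2 by nlinarith [sq_nonneg (N (τ z) - 1)]) (hN _) z rfl hz h

/-- There are smooth functions that, together with their logarithmic derivative, dominate a given
smooth function. -/
theorem exists_weight {A : ℝ → ℝ} (hA : ContDiff ℝ ∞ A) (hA1 : ∀ u, 1 ≤ A u) :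
    ∃ m : ℝ → ℝ, ContDiff ℝ ∞ m ∧ ∀ u, 0 ≤ u → A u ≤ m u ∧ A u * m u ≤ deriv m u := by
  set a : ℝ → ℝ := fun u => A u + deriv A u ^ 2 + 1 with ha
  have has : ContDiff ℝ ∞ a :=
    (hA.add ((contDiff_infty_iff_deriv.1 hA).2.pow 2)).add contDiff_const
  have ha0 : ∀ u, 0 ≤ a u := fun u => by
    have := hA1 u
    positivity
  set I : ℝ → ℝ := fun u => ∫ v in (0 : ℝ)..u, a v with hI
  have hId : ∀ u, HasDerivAt I (a u) u := fun u =>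
    intervalIntegral.integral_hasDerivAt_right (has.continuous.intervalIntegrable _ _)
      (has.continuous.stronglyMeasurableAtFilter _ _) has.continuous.continuousAt
  have hIs : ContDiff ℝ ∞ I := contDiff_infty_iff_deriv.2
    ⟨fun u => (hId u).differentiableAt, by rwa [show deriv I = a from funext fun u => (hId u).deriv]⟩
  refine ⟨fun u => A u * Real.exp (I u), hA.mul hIs.exp, fun u hu => ?_⟩
  have hA0 : 0 < A u := one_pos.trans_le (hA1 u)
  have hI0 : 0 ≤ I u := intervalIntegral.integral_nonneg hu fun v _ => ha0 v
  have hd : HasDerivAt (fun u => A u * Real.exp (I u)) _ u :=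
    (hA.differentiable (by simp) u).hasDerivAt.mul (hId u).exp
  refine ⟨le_mul_of_one_le_right hA0.le (Real.one_le_exp hI0), ?_⟩
  rw [hd.deriv]
  have hkey : A u * A u ≤ deriv A u + A u * a u := by
    rw [ha]
    have := hA1 u
    nlinarith [sq_nonneg (deriv A u + 1), sq_nonneg (deriv A u),
      mul_nonneg (sub_nonneg.2 this) (sq_nonneg (deriv A u))]
  have := mul_le_mul_of_nonneg_right hkey (Real.exp_pos (I u)).le
  linarith

end RayFunctions

section RayHamiltonian

open Bornology
open scoped ContDiff

variable {E : Type*} [NormedAddCommGroup E] [NormedSpace ℝ E]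

/-- The field `G • Y` is Hamiltonian along the zero set of `y * G`, where `Y` is the Hamiltonian
vector field of `y` and `G` is nonnegative. -/
theorem hamiltonian_mul_of_eq_zero {Ω : E → E →L[ℝ] E →L[ℝ] ℝ}
    (hnondeg : ∀ z u, (∀ v, Ω z u v = 0) → u = 0) {y G : E → ℝ} (hy : ContDiff ℝ ∞ y)
    (hG : ContDiff ℝ ∞ G) (hG0 : ∀ z, 0 ≤ G z) {X Y : E → E}
    (hY : ∀ z w, Ω z (Y z) w = fderiv ℝ y z w)
    (hX : ∀ z w, Ω z (X z) w = fderiv ℝ (fun z => y z * G z) z w) {z : E} (hz : y z * G z = 0) :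
    X z = G z • Y z := by
  have hd : fderiv ℝ (fun z => y z * G z) z = y z • fderiv ℝ G z + G z • fderiv ℝ y z :=
    fderiv_fun_mul (hy.differentiable (by simp) z) (hG.differentiable (by simp) z)
  refine sub_eq_zero.1 (hnondeg z _ fun w => ?_)
  have h0 : y z * fderiv ℝ G z w = 0 := by
    rcases mul_eq_zero.1 hz with h | h
    · rw [h, zero_mul]
    · have : IsLocalMin G z := Filter.Eventually.of_forall fun v => h ▸ hG0 v
      simp [this.fderiv_eq_zero]
  simp [hX, hY, hd, h0]

/-- A function `y * G` supported in a tube around a ray, whose Hamiltonian flow pushes exactly the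
part of the ray with parameter at least one to infinity before time one. -/
theorem exists_hamiltonian_of_ray [FiniteDimensional ℝ E] {B : E →L[ℝ] E →L[ℝ] ℝ}
    (hB : ∀ x, ‖x‖ ^ 2 ≤ B x x) {Ω : E → E →L[ℝ] E →L[ℝ] ℝ} (hΩ : ContDiff ℝ ∞ Ω)
    (halt : ∀ z u v, Ω z u v = -Ω z v u) (hnondeg : ∀ z u, (∀ v, Ω z u v = 0) → u = 0)
    {Γ : ℝ → E} (hΓ : ContDiff ℝ ∞ Γ) {τ : E → ℝ} (hτ : ContDiff ℝ ∞ τ)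
    (hτΓ : ∀ u, 0 ≤ u → τ (Γ u) = u) :
    ∃ F : E → ℝ, ContDiff ℝ ∞ F ∧ ∃ X : E → E, ContDiff ℝ ∞ X ∧
      (∀ z w, Ω z (X z) w = fderiv ℝ F z w) ∧
      (∀ u, 0 < u → X (Γ u) = raySpeed u • deriv Γ u) ∧
      (∀ z ∉ Γ '' Ici 1, ∃ c, c 0 = z ∧ SolvesOn X 1 c) ∧
      ∀ z, ∃ c, c 0 = z ∧ SolvesOn (fun z => -X z) 1 c := by
  set r := raySq B Γ τ with hr_def
  set y := rayHeight Ω Γ τ with hy_def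
  have hr : ContDiff ℝ ∞ r := contDiff_raySq hΓ hτ
  have hy : ContDiff ℝ ∞ y := contDiff_rayHeight hΩ hΓ hτ
  have hr0 : ∀ z, 0 ≤ r z := fun z => (sq_nonneg _).trans (hB _)
  have hyΓ : ∀ u, 0 ≤ u → y (Γ u) = 0 := fun u hu => rayHeight_ray hτΓ hu
  obtain ⟨Y, hY, hYy⟩ := exists_hamiltonian_vectorField hΩ hnondeg hy
  have hYΓ : ∀ u, 0 ≤ u → Y (Γ u) = deriv Γ u := fun u hu =>
    sub_eq_zero.1 (hnondeg (Γ u) _ fun w => by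
      simp [hYy, hy_def, fderiv_rayHeight_ray hΩ halt hΓ hτ hτΓ hu])
  obtain ⟨A, hA, hA1, hAr⟩ := exists_tube_control hB hΩ hΓ hτ hτΓ hY hYΓ
  have hg : ContDiff ℝ ∞ raySpeed := contDiff_raySpeed
  obtain ⟨m, hm, hmA⟩ := exists_weight
    (A := fun u => 1 + 2 * A u + (A u * raySpeed u * (1 + u)) ^ 2)
    ((contDiff_const.add (contDiff_const.mul hA)).add
      (((hA.mul hg).mul (contDiff_const.add contDiff_id)).pow 2))
    (fun u => by have := hA1 u; nlinarith [sq_nonneg (A u * raySpeed u * (1 + u))])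
  have hmAu : ∀ u, 0 ≤ u → A u ≤ m u := fun u hu => by
    have := hA1 u
    nlinarith [(hmA u hu).1, sq_nonneg (A u * raySpeed u * (1 + u))]
  have hm1 : ∀ u, 0 ≤ u → 1 ≤ m u := fun u hu => (hA1 u).trans (hmAu u hu)
  set G : E → ℝ := fun z => raySpeed (τ z) * Real.smoothTransition (1 - m (τ z) * r z) with hG_def
  have hGs : ContDiff ℝ ∞ G := (hg.comp hτ).mul
    (Real.smoothTransition.contDiff.comp (contDiff_const.sub ((hm.comp hτ).mul hr)))
  have hG0 : ∀ z, 0 ≤ G z := fun z =>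
    mul_nonneg (raySpeed_nonneg _) (Real.smoothTransition.nonneg _)
  have hGpos : ∀ z, 0 < G z → 0 < τ z ∧ m (τ z) * r z < 1 := fun z hz => by
    constructor <;> by_contra! h
    · exact hz.ne' (by rw [hG_def]; simp [raySpeed_of_nonpos h])
    · exact hz.ne' (by
        rw [hG_def]; simp [Real.smoothTransition.zero_of_nonpos (sub_nonpos.2 h)])
  have htube : ∀ z, 0 < G z → 1 / 2 ≤ fderiv ℝ τ z (Y z) ∧
      |fderiv ℝ r z (Y z)| ≤ A (τ z) * r z ∧ |y z| ≤ A (τ z) * ‖rayOffset Γ τ z‖ := fun z hz => by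
    obtain ⟨h1, h2⟩ := hGpos z hz
    exact hAr z h1.le ((mul_le_mul_of_nonneg_right (hmAu _ h1.le) (hr0 z)).trans_lt h2)
  have hτb : ∀ T, IsBounded {z | 0 < G z ∧ τ z ≤ T} := fun T => by
    obtain ⟨C, hC⟩ := (isCompact_Icc.image hΓ.continuous).isBounded.exists_norm_le (s := Γ '' Icc 0 T)
    refine (isBounded_iff_forall_norm_le).2 ⟨1 + C, fun z hz => ?_⟩
    obtain ⟨h1, h2⟩ := hGpos z hz.1
    have h3 : ‖rayOffset Γ τ z‖ ^ 2 ≤ 1 := (sq_norm_rayOffset_le hB z).trans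
      ((le_mul_of_one_le_left (hr0 z) (hm1 _ h1.le)).trans h2.le)
    have h4 : ‖rayOffset Γ τ z‖ ≤ 1 := (pow_le_one_iff_of_nonneg (norm_nonneg _) two_ne_zero).1 h3
    calc ‖z‖ = ‖rayOffset Γ τ z + Γ (τ z)‖ := by rw [rayOffset, sub_add_cancel]
      _ ≤ 1 + C := norm_add_le_of_le h4 (hC _ ⟨τ z, ⟨h1.le, hz.2⟩, rfl⟩)
  have hF : ContDiff ℝ ∞ (fun z => y z * G z) := hy.mul hGs
  have hFb : ∀ ε > 0, IsBounded {z | ε ≤ |y z * G z|} := fun ε hε => by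
    refine (hτb ε⁻¹).subset fun z hz => ?_
    have hz : ε ≤ |y z * G z| := hz
    have hGz : 0 < G z := (hG0 z).lt_of_ne fun h => by
      rw [← h, mul_zero, abs_zero] at hz
      exact hz.not_gt hε
    refine ⟨hGz, ?_⟩
    obtain ⟨h1, h2⟩ := hGpos z hGz
    have h3 : G z ≤ raySpeed (τ z) :=
      mul_le_of_le_one_right (raySpeed_nonneg _) (Real.smoothTransition.le_one _)
    have hA0 : 0 ≤ A (τ z) := zero_le_one.trans (hA1 _)
    have hg0 := raySpeed_nonneg (τ z)
    have h4 : |y z * G z| ≤ A (τ z) * ‖rayOffset Γ τ z‖ * raySpeed (τ z) := by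
      rw [abs_mul, abs_of_pos hGz]
      exact mul_le_mul (htube z hGz).2.2 h3 hGz.le (by positivity)
    have h5 : (A (τ z) * ‖rayOffset Γ τ z‖ * raySpeed (τ z) * (1 + τ z)) ^ 2 ≤ 1 := by
      calc _ = (A (τ z) * raySpeed (τ z) * (1 + τ z)) ^ 2 * ‖rayOffset Γ τ z‖ ^ 2 := by ring
        _ ≤ m (τ z) * r z := by
          have := (hmA _ h1.le).1
          gcongr
          · exact zero_le_one.trans (hm1 _ h1.le)
          · linarith
          · exact sq_norm_rayOffset_le hB z
        _ ≤ 1 := h2.le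
    have h6 := (pow_le_one_iff_of_nonneg (by positivity) two_ne_zero).1 h5
    rw [← one_div, le_div_iff₀ hε]
    nlinarith [mul_le_mul_of_nonneg_right (hz.trans h4) h1.le, hz.trans h4]
  obtain ⟨X, hX, hXF⟩ := exists_hamiltonian_vectorField hΩ hnondeg hF
  have hXdF : ∀ z, fderiv ℝ (fun z => y z * G z) z (X z) = 0 := fun z => by
    rw [← hXF]
    linarith [halt z (X z) (X z)]
  have hXG : ∀ z, y z * G z = 0 → X z = G z • Y z := fun z =>
    hamiltonian_mul_of_eq_zero hnondeg hy hGs hG0 hYy hXF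
  have hXΓ : ∀ u, 0 < u → X (Γ u) = raySpeed u • deriv Γ u := fun u hu => by
    rw [hXG _ (by rw [hyΓ u hu.le, zero_mul]), hYΓ u hu.le, hG_def]
    simp [hr_def, raySq, rayOffset_ray hτΓ hu.le, hτΓ u hu.le,
      Real.smoothTransition.one_of_one_le le_rfl]
  refine ⟨_, hF, X, hX, hXF, hXΓ, fun z hz => ?_, exists_solvesOn_backward hX hF hXdF hFb hG0 hXG hτ
    (fun z hz => by linarith [(htube z hz).1]) hτb⟩
  by_cases hray : 0 < G z ∧ r z = 0
  · have h1 : rayOffset Γ τ z = 0 := by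
      have := sq_norm_rayOffset_le hB (Γ := Γ) (τ := τ) z
      rw [← hr_def, hray.2] at this
      exact norm_eq_zero.1 (pow_eq_zero_iff two_ne_zero |>.1 (this.antisymm (sq_nonneg _)))
    have h2 : Γ (τ z) = z := (sub_eq_zero.1 h1).symm
    have h3 : τ z < 1 := by
      by_contra! h
      exact hz ⟨τ z, h, h2⟩
    obtain ⟨c, hc0, hc⟩ := exists_solvesOn_ray hΓ hXΓ (hGpos z hray.1).1 h3
    exact ⟨c, hc0.trans h2, hc⟩
  · refine exists_solvesOn_forward (κ := fun z => m (τ z) * r z * Real.exp (-τ z)) hX hF hXdF hFb hG0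
      hXG hτb (((hm.comp hτ).mul hr).mul hτ.neg.exp) (fun z hz => ?_) (fun z hz => ?_)
      fun _ hGz => ?_
    · obtain ⟨h1, h2⟩ := hGpos z hz
      obtain ⟨h3, h4, -⟩ := htube z hz
      have hdτ := (hτ.differentiable (by simp) z).hasFDerivAt
      have hd : HasFDerivAt (fun z => m (τ z) * r z * Real.exp (-τ z)) _ z :=
        (((hm.differentiable (by simp) (τ z)).hasDerivAt.comp_hasFDerivAt z hdτ).mul
          (hr.differentiable (by simp) z).hasFDerivAt).mul hdτ.neg.exp
      have hval : fderiv ℝ (fun z => m (τ z) * r z * Real.exp (-τ z)) z (Y z) =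
          Real.exp (-τ z) * ((deriv m (τ z) - m (τ z)) * r z * fderiv ℝ τ z (Y z) +
            m (τ z) * fderiv ℝ r z (Y z)) := by
        rw [hd.fderiv]
        simp
        ring
      rw [hval]
      refine mul_nonneg (Real.exp_pos _).le ?_
      have hm0 := zero_le_one.trans (hm1 _ h1.le)
      have h5 : 2 * A (τ z) * m (τ z) ≤ deriv m (τ z) - m (τ z) := by
        nlinarith [(hmA _ h1.le).2, mul_nonneg (sq_nonneg (A (τ z) * raySpeed (τ z) * (1 + τ z))) hm0]
      have h6 : 2 * A (τ z) * m (τ z) * r z * (1 / 2) ≤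
          (deriv m (τ z) - m (τ z)) * r z * fderiv ℝ τ z (Y z) := by
        have hA0 : 0 ≤ A (τ z) := zero_le_one.trans (hA1 _)
        have hrz := hr0 z
        exact mul_le_mul (mul_le_mul_of_nonneg_right h5 hrz) h3 (by norm_num)
          (mul_nonneg ((by positivity : (0 : ℝ) ≤ 2 * A (τ z) * m (τ z)).trans h5) hrz)
      nlinarith [mul_le_mul_of_nonneg_left (neg_le_of_abs_le h4) hm0]
    · exact mul_le_of_le_one_left (Real.exp_pos _).le (hGpos z hz).2.le
    · have h1 : 0 < r z := (hr0 z).lt_of_ne fun h => hray ⟨hGz, h.symm⟩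
      exact mul_pos (mul_pos (one_pos.trans_le (hm1 _ (hGpos z hGz).1.le)) h1) (Real.exp_pos _)

/-- The standard inner product dominates the square of the sup norm. -/
theorem exists_bilinear_sq_norm_le (ι : Type*) [Fintype ι] :
    ∃ B : (ι → ℝ) →L[ℝ] (ι → ℝ) →L[ℝ] ℝ, ∀ x, ‖x‖ ^ 2 ≤ B x x := by
  refine ⟨∑ i, (ContinuousLinearMap.proj (R := ℝ) (φ := fun _ : ι => ℝ) i).smulRight
    (ContinuousLinearMap.proj (R := ℝ) (φ := fun _ : ι => ℝ) i), fun x => ?_⟩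
  have h : ‖x‖ ≤ √(∑ i, x i * x i) := (pi_norm_le_iff_of_nonneg (Real.sqrt_nonneg _)).2 fun i =>
    Real.abs_le_sqrt ((sq (x i)).trans_le
      (Finset.single_le_sum (fun i _ => mul_self_nonneg (x i)) (Finset.mem_univ i)))
  have := (Real.le_sqrt (norm_nonneg _) (Finset.sum_nonneg fun i _ => mul_self_nonneg (x i))).1 h
  simpa [sum_apply] using this

end RayHamiltonian

/-- Any properly embedded ray `R = γ([0,∞))` in a symplectic manifold `(ℝ^{2n}, ω)`
is time-independent Hamiltonian excisable.

Here `ω` assigns smoothly to each `z` an alternating, nondegenerate bilinear form, and is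
closed: `(Dω_z u)(v,w) + (Dω_z v)(w,u) + (Dω_z w)(u,v) = 0`.  The conclusion produces a
smooth `F : ℝ^{2n} → ℝ` whose Hamiltonian vector field `X` (characterized by
`ω_z(X z, w) = dF_z w`) has: forward trajectories starting in `R` stay in `R` as long
as they are defined; trajectories starting in `ℝ^{2n} ∖ R` are defined at least on `[0,1]`;
and the time-1 flow map `φ` is a symplectomorphism from `ℝ^{2n} ∖ R` onto `ℝ^{2n}`. -/
theorem ray_excisable_general_symplectic (n : ℕ) (hn : 1 ≤ n)
    (ω : (Fin (2*n) → ℝ) → ((Fin (2*n) → ℝ) →L[ℝ] (Fin (2*n) → ℝ) →L[ℝ] ℝ))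
    (hω_smooth : ContDiff ℝ (⊤ : ℕ∞) ω)
    (hω_alt : ∀ z u v, ω z u v = - ω z v u)
    (hω_nondeg : ∀ z u, (∀ v, ω z u v = 0) → u = 0)
    (hω_closed : ∀ z u v w,
      fderiv ℝ ω z u v w + fderiv ℝ ω z v w u + fderiv ℝ ω z w u v = 0)
    (γ : ℝ → (Fin (2*n) → ℝ))
    (hγ_smooth : ContDiffOn ℝ (⊤ : ℕ∞) γ (Ici 0))
    (hγ_inj : InjOn γ (Ici 0))
    (hγ_proper : ∀ K : Set (Fin (2*n) → ℝ), IsCompact K → IsCompact {t : ℝ | 0 ≤ t ∧ γ t ∈ K})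
    (hγ_imm : ∀ t ∈ Ici (0:ℝ), derivWithin γ (Ici 0) t ≠ 0) :
    ∃ F : (Fin (2*n) → ℝ) → ℝ, ContDiff ℝ (⊤ : ℕ∞) F ∧
    ∃ X : (Fin (2*n) → ℝ) → (Fin (2*n) → ℝ),
      (∀ z w, ω z (X z) w = fderiv ℝ F z w) ∧
      (∀ (c : ℝ → (Fin (2*n) → ℝ)) (T : ℝ), 0 ≤ T → c 0 ∈ γ '' Ici 0 →
        (∀ t ∈ Icc 0 T, HasDerivAt c (X (c t)) t) →
        ∀ t ∈ Icc 0 T, c t ∈ γ '' Ici 0) ∧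
      ∃ φ : (Fin (2*n) → ℝ) → (Fin (2*n) → ℝ),
        (∀ z ∉ γ '' Ici 0, ∃ c : ℝ → (Fin (2*n) → ℝ), c 0 = z ∧
          (∀ t ∈ Icc (0:ℝ) 1, HasDerivAt c (X (c t)) t) ∧ c 1 = φ z) ∧
        ContDiffOn ℝ (⊤ : ℕ∞) φ (γ '' Ici 0)ᶜ ∧
        BijOn φ (γ '' Ici 0)ᶜ univ ∧
        (∃ ψ, ContDiff ℝ (⊤ : ℕ∞) ψ ∧ InvOn ψ φ (γ '' Ici 0)ᶜ univ) ∧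
        (∀ z ∉ γ '' Ici 0, ∀ u v,
          ω (φ z) (fderiv ℝ φ z u) (fderiv ℝ φ z v) = ω z u v) := by
  obtain ⟨Γ, τ, hΓ, hτ, hτΓ, hR⟩ :=
    exists_prolongation_of_proper hγ_smooth hγ_inj hγ_imm hγ_proper
  obtain ⟨B, hB⟩ := exists_bilinear_sq_norm_le (Fin (2 * n))
  obtain ⟨F, hF, X, hX, hXF, hXΓ, hforward, hbackward⟩ :=
    exists_hamiltonian_of_ray hB hω_smooth hω_alt hω_nondeg hΓ hτ hτΓ
  have hray : ∀ (c : ℝ → (Fin (2*n) → ℝ)) (T : ℝ), c 0 ∈ Γ '' Ici 1 → SolvesOn X T c →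
      T < 1 ∧ ∀ t ∈ Icc 0 T, c t ∈ Γ '' Ici 1 := by
    rintro c T ⟨u, hu, hc0⟩ hc
    exact hc.lt_one_of_ray hX hΓ hτ.continuous hτΓ hXΓ hu hc0.symm
  have hclosed : IsClosed (Γ '' Ici 1) := by
    have : Γ '' Ici 1 = {z | Γ (τ z) = z} ∩ {z | 1 ≤ τ z} := by
      ext z
      constructor
      · rintro ⟨u, hu, rfl⟩
        have := hτΓ u (zero_le_one.trans hu)
        exact ⟨congrArg Γ this, hu.trans_eq this.symm⟩
      · exact fun hz => ⟨τ z, hz.2, hz.1⟩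
    rw [this]
    exact (isClosed_eq (hΓ.continuous.comp hτ.continuous) continuous_id).inter
      (isClosed_le continuous_const hτ.continuous)
  rw [← hR]
  exact ⟨F, hF, X, hXF, fun c T _ hc0 hc => (hray c T hc0 hc).2,
    exists_symplectic_timeOne_map hω_smooth hω_alt hω_closed hF hX hXF hclosed hforward
      (fun c hc0 hc => lt_irrefl _ (hray c 1 hc0 hc).1) hbackward⟩
end
end

section
/- Let n ≥ 1 and let N = {z ∈ ℝ^{2n} : y_n = 0}, a codimension-one linear submanifold of (ℝ^{2n}, ω_can), on which the null directions of the restricted form ω_can|_N are spanned by e := ∂/∂x_n. Let v : N → ℝ be smooth, let Z ⊆ N be closed as a subset of ℝ^{2n}, and suppose v(q) ≠ 0 for every q ∈ Z. Then there exist smooth functions χ : ℝ^{2n} → [0,1] and F : ℝ^{2n} → ℝ such that: (i) χ = 1 on Z; (ii) X_F(q) = χ(q) v(q) e for every q ∈ N; and (iii) every maximal integral curve of X_F that meets ℝ^{2n} ∖ N is defined for all t ∈ ℝ. -/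
open Set

noncomputable section

/-- The hyperplane `N = {yₙ = 0}`. -/
def Nset (m : ℕ) : Set (EE m) := {z | z.2.2 = 0}

/-- The basis vector `e = ∂/∂xₙ`. -/
def eVec (m : ℕ) : EE m := (0, 1, 0)

open scoped NNReal Topology

theorem exists_integralCurve_of_lipschitzWith_of_norm_le {E : Type*} [NormedAddCommGroup E]
    [NormedSpace ℝ E] [CompleteSpace E] {Y : E → E} {K L : ℝ≥0} (hK : LipschitzWith K Y)
    (hL : ∀ z, ‖Y z‖ ≤ L) (z : E) :
    ∃ γ : ℝ → E, γ 0 = z ∧ ∀ t, HasDerivAt γ (Y (γ t)) t := by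
  have hloc : ∀ T : ℝ, ∃ α : ℝ → E, 0 < T →
      α 0 = z ∧ ∀ t ∈ Ioo (-T) T, HasDerivAt α (Y (α t)) t := by
    intro T
    by_cases hT : 0 < T
    swap
    · exact ⟨fun _ => z, fun h => absurd h hT⟩
    have hPL : IsPicardLindelof (fun _ => Y) (tmin := -T) (tmax := T) ⟨0, by simp [hT.le]⟩ z
        (L * T.toNNReal) 0 L K :=
      .of_time_independent (fun x _ => hL x) hK.lipschitzOnWith (by simp [hT.le])
    obtain ⟨α, h0, hα⟩ := hPL.exists_eq_forall_mem_Icc_hasDerivWithinAt₀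
    exact ⟨α, fun _ => ⟨h0, fun t ht =>
      (hα t (Ioo_subset_Icc_self ht)).hasDerivAt (Icc_mem_nhds ht.1 ht.2)⟩⟩
  choose α hα using hloc
  have hagree : ∀ S T t : ℝ, S ≤ T → |t| < S → α S t = α T t := by
    intro S T t hST ht
    have hS : 0 < S := (abs_nonneg t).trans_lt ht
    have hT : 0 < T := hS.trans_le hST
    refine ODE_solution_unique_of_mem_Ioo (v := fun _ => Y) (s := fun _ => univ) (K := K)
      (a := -S) (b := S) (t₀ := 0) (fun _ _ => hK.lipschitzOnWith) ⟨by linarith, hS⟩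
      (fun s hs => ⟨(hα S hS).2 s hs, mem_univ _⟩)
      (fun s hs => ⟨(hα T hT).2 s ⟨by linarith [hs.1], by linarith [hs.2]⟩, mem_univ _⟩)
      ((hα S hS).1.trans (hα T hT).1.symm) (abs_lt.1 ht)
  refine ⟨fun t => α (|t| + 1) t, by simpa using (hα (|0| + 1) (by positivity)).1, fun t => ?_⟩
  have hev : (fun s => α (|s| + 1) s) =ᶠ[𝓝 t] α (|t| + 2) := by
    have : ∀ᶠ s in 𝓝 t, |s| < |t| + 1 :=
      continuous_abs.continuousAt.eventually_lt continuousAt_const (by linarith)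
    filter_upwards [this] with s hs
    exact hagree _ _ s (by linarith) (by linarith)
  have h := (hα (|t| + 2) (by positivity)).2 t (abs_lt.1 (by linarith))
  rw [← hev.self_of_nhds] at h
  exact h.congr_of_eventuallyEq hev

/-- A vector field with a first integral is complete along bounded level sets. -/
theorem exists_integralCurve_of_isBounded_level {E : Type*} [NormedAddCommGroup E]
    [NormedSpace ℝ E] [FiniteDimensional ℝ E] {X : E → E} (hX : ContDiff ℝ 1 X) {F : E → ℝ}
    (hF : Differentiable ℝ F) (hFX : ∀ z, fderiv ℝ F z (X z) = 0) (z : E)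
    (hb : Bornology.IsBounded {w | F w = F z}) :
    ∃ γ : ℝ → E, γ 0 = z ∧ ∀ t, HasDerivAt γ (X (γ t)) t := by
  have : CompleteSpace E := FiniteDimensional.complete ℝ E
  obtain ⟨R, hR, hsub⟩ := hb.subset_closedBall_lt 0 0
  let ρ : ContDiffBump (0 : E) := ⟨R, R + 1, hR, by linarith⟩
  have hY : ContDiff ℝ 1 fun w => ρ w • X w := ρ.contDiff.smul hX
  have hYc : HasCompactSupport fun w => ρ w • X w := ρ.hasCompactSupport.smul_right
  obtain ⟨K, hK⟩ := hY.lipschitzWith_of_hasCompactSupport hYc one_ne_zero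
  obtain ⟨C, hC⟩ := hYc.exists_bound_of_continuous hY.continuous
  obtain ⟨γ, h0, hγ⟩ := exists_integralCurve_of_lipschitzWith_of_norm_le (L := C.toNNReal) hK
    (fun w => (hC w).trans (Real.le_coe_toNNReal C)) z
  have hconst : ∀ t, F (γ t) = F z := by
    have hd : ∀ t, HasDerivAt (F ∘ γ) 0 t := fun t => by
      have := (hF (γ t)).hasFDerivAt.comp_hasDerivAt t (hγ t)
      simpa [hFX] using this
    intro t
    rw [← h0]
    exact is_const_of_deriv_eq_zero (fun t => (hd t).differentiableAt) (fun t => (hd t).deriv) t 0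
  refine ⟨γ, h0, fun t => ?_⟩
  have h1 : ρ (γ t) = 1 := ρ.one_of_mem_closedBall (hsub (hconst t))
  simpa [h1] using hγ t

/-- The symplectic gradient: the vector dual to the covector `l` with respect to `wcan`. -/
def sharp (m : ℕ) (l : EE m →L[ℝ] ℝ) : EE m :=
  ((fun i => l ((0, Pi.single i 1), 0), fun i => -l ((Pi.single i 1, 0), 0)),
    l (0, 0, 1), -l (0, 1, 0))

theorem wcan_sharp (m : ℕ) (l : EE m →L[ℝ] ℝ) (w : EE m) : wcan m (sharp m l) w = l w := by
  obtain ⟨⟨p, q⟩, x, y⟩ := w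
  have hs : ∀ i : Fin m, (fun j => if i = j then (1 : ℝ) else 0) = Pi.single i 1 := fun i => by
    ext j
    simp [Pi.single_apply, eq_comm]
  have hp : l ((p, 0), 0) = ∑ i, p i * l ((Pi.single i 1, 0), 0) := by
    simpa [hs] using
      (l.toLinearMap ∘ₗ LinearMap.inl ℝ _ _ ∘ₗ LinearMap.inl ℝ _ _).pi_apply_eq_sum_univ p
  have hq : l ((0, q), 0) = ∑ i, q i * l ((0, Pi.single i 1), 0) := by
    simpa [hs] using
      (l.toLinearMap ∘ₗ LinearMap.inl ℝ _ _ ∘ₗ LinearMap.inr ℝ _ _).pi_apply_eq_sum_univ q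
  have hx : l (0, x, 0) = x * l (0, 1, 0) := by
    rw [← smul_eq_mul, ← map_smul]; simp
  have hy : l (0, 0, y) = y * l (0, 0, 1) := by
    rw [← smul_eq_mul, ← map_smul]; simp
  have hw : (((p, q), x, y) : EE m) = ((p, 0), 0) + ((0, q), 0) + (0, x, 0) + (0, 0, y) := by
    simp
  rw [hw, map_add, map_add, map_add, hp, hq, hx, hy, ← hw]
  simp only [wcan, wB, sharp, sub_neg_eq_add, neg_mul, Finset.sum_add_distrib]
  simp only [mul_comm]
  ring

theorem wcan_self (m : ℕ) (u : EE m) : wcan m u u = 0 := by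
  simp [wcan, wB, mul_comm]

theorem sharp_zero (m : ℕ) : sharp m 0 = 0 := by
  ext <;> simp [sharp]

theorem ContDiff.sharp {m : ℕ} {k : WithTop ℕ∞} {l : EE m → EE m →L[ℝ] ℝ} (hl : ContDiff ℝ k l) :
    ContDiff ℝ k fun z => sharp m (l z) := by
  have h : ∀ u : EE m, ContDiff ℝ k fun z => l z u := fun u => hl.clm_apply contDiff_const
  exact ((contDiff_pi.2 fun i => h _).prodMk (contDiff_pi.2 fun i => (h _).neg)).prodMk
    ((h _).prodMk (h _).neg)

/-- The projection of `ℝ^{2n}` onto the hyperplane `Nset m`. -/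
def projN (m : ℕ) : EE m → EE m := fun z => (z.1, z.2.1, 0)

theorem contDiff_projN (m : ℕ) {k : WithTop ℕ∞} : ContDiff ℝ k (projN m) := by
  unfold projN; fun_prop

theorem projN_mem (m : ℕ) (z : EE m) : projN m z ∈ Nset m := rfl

theorem projN_of_mem {m : ℕ} {z : EE m} (hz : z ∈ Nset m) : projN m z = z :=
  Prod.ext rfl (Prod.ext rfl (Eq.symm hz))

theorem fderiv_eq_zero_of_nonneg_of_eq_zero {E : Type*} [NormedAddCommGroup E] [NormedSpace ℝ E]
    {χ : E → ℝ} (hχ : ∀ z, 0 ≤ χ z) {z : E} (hz : χ z = 0) : fderiv ℝ χ z = 0 :=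
  IsLocalMin.fderiv_eq_zero (Filter.Eventually.of_forall fun w => hz ▸ hχ w)

theorem four_mul_sq_mul_le_one {y χ w H k c : ℝ} (hχ0 : 0 ≤ χ) (hχ1 : χ ≤ 1) (hk : 1 ≤ k)
    (hH : H = (1 + w ^ 2) * k) (hc : χ * (y * w / (1 + y ^ 2 * H)) = c) :
    4 * c ^ 2 * k ≤ 1 := by
  have hHpos : 0 < H := by rw [hH]; positivity
  have hD : 0 < 1 + y ^ 2 * H := by positivity
  have h1 : c ^ 2 * (1 + y ^ 2 * H) ^ 2 = χ ^ 2 * (y * w) ^ 2 := by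
    rw [← hc]; field_simp
  have h2 : χ ^ 2 * (y * w) ^ 2 ≤ (y * w) ^ 2 :=
    mul_le_of_le_one_left (sq_nonneg _) (pow_le_one₀ hχ0 hχ1)
  have h3 : 4 * (y ^ 2 * H) ≤ (1 + y ^ 2 * H) ^ 2 := by nlinarith [sq_nonneg (1 - y ^ 2 * H)]
  have h4 : c ^ 2 * (4 * (y ^ 2 * H)) ≤ y ^ 2 * w ^ 2 := by
    nlinarith [mul_le_mul_of_nonneg_left h3 (sq_nonneg c)]
  rcases eq_or_ne y 0 with rfl | hy
  · have : c = 0 := by simpa using hc.symm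
    simp [this]
  have hy2 : 0 < y ^ 2 := by positivity
  have h5 : 4 * c ^ 2 * k * (1 + w ^ 2) ≤ w ^ 2 := by
    refine le_of_mul_le_mul_left ?_ hy2
    rw [hH] at h4
    linarith
  by_contra! h6
  nlinarith [mul_lt_mul_of_pos_right h6 (show 0 < 1 + w ^ 2 by positivity)]

/-- Extension of null vector fields: let `N = {yₙ = 0} ⊂ ℝ^{2n}`, whose null directions
are spanned by `e = ∂/∂xₙ`; let `v` be smooth on `N`, let `Z ⊆ N` be closed in `ℝ^{2n}`
with `v ≠ 0` on `Z`.  Then there are smooth `χ : ℝ^{2n} → [0,1]` and `F : ℝ^{2n} → ℝ`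
such that `χ = 1` on `Z`, the Hamiltonian vector field `X = X_F` of `F` (characterized by
`ω_can(X z, w) = dF_z w`) satisfies `X q = χ(q) v(q) e` for `q ∈ N`, and every maximal
integral curve of `X_F` meeting `ℝ^{2n} ∖ N` is defined for all times. -/
theorem extension_of_null_vector_fields (m : ℕ)
    (v : EE m → ℝ) (hv : ContDiffOn ℝ (⊤ : ℕ∞) v (Nset m))
    (Z : Set (EE m)) (hZN : Z ⊆ Nset m) (hZclosed : IsClosed Z)
    (hvZ : ∀ q ∈ Z, v q ≠ 0) :
    ∃ χ F : EE m → ℝ,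
      ContDiff ℝ (⊤ : ℕ∞) χ ∧ ContDiff ℝ (⊤ : ℕ∞) F ∧
      (∀ z, χ z ∈ Icc (0:ℝ) 1) ∧
      (∀ q ∈ Z, χ q = 1) ∧
      ∃ X : EE m → EE m,
        (∀ z w, wcan m (X z) w = fderiv ℝ F z w) ∧
        (∀ q ∈ Nset m, X q = (χ q * v q) • eVec m) ∧
        (∀ z ∉ Nset m, ∃ γ : ℝ → EE m, γ 0 = z ∧
          ∀ t : ℝ, HasDerivAt γ (X (γ t)) t) := by
  let w : EE m → ℝ := fun z => v (projN m z)
  have hw : ContDiff ℝ (⊤ : ℕ∞) w := hv.comp_contDiff (contDiff_projN m) (projN_mem m)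
  have hwN : ∀ q ∈ Nset m, w q = v q := fun q hq => congrArg v (projN_of_mem hq)
  obtain ⟨χ, hχ0, hχ1, hχI⟩ := exists_contMDiffMap_zero_one_of_isClosed
    (modelWithCornersSelf ℝ (EE m)) (n := (⊤ : ℕ∞)) (isClosed_singleton.preimage hw.continuous : IsClosed (w ⁻¹' {0}))
    hZclosed
    (disjoint_left.2 fun q hq hqZ => hvZ q hqZ ((hwN q (hZN hqZ)).symm.trans hq))
  have hχ : ContDiff ℝ (⊤ : ℕ∞) χ := χ.contMDiff.contDiff
  let k : EE m → ℝ := fun z => 1 + ‖toEuclidean z‖ ^ 2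
  have hk : ContDiff ℝ (⊤ : ℕ∞) k :=
    contDiff_const.add ((toEuclidean (E := EE m)).contDiff.norm_sq ℝ)
  have hk1 : ∀ z, 1 ≤ k z := fun z => le_add_of_nonneg_right (sq_nonneg _)
  let g : EE m → ℝ := fun z => w z / (1 + z.2.2 ^ 2 * ((1 + w z ^ 2) * k z))
  have hg : ContDiff ℝ (⊤ : ℕ∞) g := by
    refine hw.div (by fun_prop) fun z => ?_
    have := hk1 z
    positivity
  let A : EE m → ℝ := fun z => z.2.2 * g z
  have hA : ContDiff ℝ (⊤ : ℕ∞) A := by fun_prop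
  let F : EE m → ℝ := fun z => χ z * A z
  have hF : ContDiff ℝ (⊤ : ℕ∞) F := hχ.mul hA
  have hFd : ∀ z, fderiv ℝ F z = χ z • fderiv ℝ A z + A z • fderiv ℝ χ z := fun z =>
    fderiv_fun_mul (hχ.differentiable (by simp) z) (hA.differentiable (by simp) z)
  have hAd : ∀ z ∈ Nset m, ∀ u, fderiv ℝ A z u = v z * u.2.2 := by
    intro z hz u
    have hz' : z.2.2 = 0 := hz
    have hy : HasFDerivAt (fun z : EE m => z.2.2)
        ((ContinuousLinearMap.snd ℝ ℝ ℝ).comp (ContinuousLinearMap.snd ℝ _ _)) z :=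
      hasFDerivAt_snd.comp z hasFDerivAt_snd
    have := (hy.mul (hg.differentiable (by simp) z).hasFDerivAt).fderiv
    have hgz : g z = v z := by simp [g, hz', hwN z hz]
    change fderiv ℝ A z = _ at this
    simp [this, hz', hgz]
  have hcrit : ∀ z ∉ Nset m, F z = 0 → fderiv ℝ F z = 0 := by
    intro z hz h0
    have hχz : χ z = 0 := by
      rcases mul_eq_zero.1 h0 with h | h
      · exact h
      refine hχ0 ?_
      have hgz : g z = 0 := (mul_eq_zero.1 h).resolve_left hz
      refine (div_eq_zero_iff.1 hgz).resolve_right ?_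
      have := hk1 z
      positivity
    rw [hFd, hχz, fderiv_eq_zero_of_nonneg_of_eq_zero (fun z => (hχI z).1) hχz]
    simp
  refine ⟨χ, F, hχ, hF, hχI, hχ1, fun z => sharp m (fderiv ℝ F z),
    fun z u => wcan_sharp m _ u, fun q hq => ?_, fun z hz => ?_⟩
  · have hAq : A q = 0 := by
      have hq' : q.2.2 = 0 := hq
      simp [A, hq']
    ext <;> simp [hFd, hAq, sharp, hAd q hq, eVec]
  by_cases h0 : F z = 0
  · refine ⟨fun _ => z, rfl, fun t => ?_⟩
    simpa [hcrit z hz h0, sharp_zero] using hasDerivAt_const t z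
  · refine exists_integralCurve_of_isBounded_level
      (hF.fderiv_right (m := 1) (by norm_cast)).sharp
      (hF.differentiable (by simp)) (fun u => ?_) z ?_
    · rw [← wcan_sharp, wcan_self]
    refine (Euclidean.isCompact_closedBall (x := (0 : EE m))
      (r := √(1 / (4 * F z ^ 2)))).isBounded.subset fun u hu => ?_
    have hle := four_mul_sq_mul_le_one (hχI u).1 (hχI u).2 (hk1 u) rfl
      ((congrArg (χ u * ·) (mul_div_assoc _ _ _)).trans (hu : F u = F z))
    have hpos : 0 < 4 * F z ^ 2 := by positivity
    change dist (toEuclidean u) (toEuclidean 0) ≤ _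
    rw [map_zero, dist_zero_right]
    apply Real.le_sqrt_of_sq_le
    rw [le_div_iff₀ hpos]
    simp only [k] at hle
    nlinarith
end
end
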